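/- arXiv:2309.12248 — 3 statements merged into one kernel-verified Lean document; each statement's English description precedes it below -/
import Mathlib

section
/- Let G = (V, E) be a rigidity circuit and suppose G = CRes(G1, G2, e) where G1 = (V1, E1) and G2 = (V2, E2) are rigidity circuits with e ∈ E1 ∩ E2, and where |V1| < |V| and |V2| < |V|. Then the common part (V1 ∩ V2, E1 ∩ E2) is a Laman graph on vertex set V1 ∩ V2; in particular |E1 ∩ E2| = 2|V1 ∩ V2| − 3. -/
open scoped Classical

noncomputable section

/-- The set of edges of `E` with both endpoints in `V'`. -/
def spans (E : Finset (Sym2 ℕ)) (V' : Finset ℕ) : Finset (Sym2 ℕ) :=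
  E.filter (fun e => ∀ v ∈ e, v ∈ V')

/-- `(V, E)` is a simple graph: edges are non-loops with both endpoints in `V`. -/
def IsGraph (V : Finset ℕ) (E : Finset (Sym2 ℕ)) : Prop :=
  ∀ e ∈ E, ¬ e.IsDiag ∧ ∀ v ∈ e, v ∈ V

/-- A rigidity circuit: a simple graph with `|E| = 2|V| - 2` such that every proper
subset `V' ⊊ V` with `|V'| ≥ 2` spans at most `2|V'| - 3` edges. -/
def IsRigidityCircuit (V : Finset ℕ) (E : Finset (Sym2 ℕ)) : Prop :=
  IsGraph V E ∧ E.card = 2 * V.card - 2 ∧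
    ∀ V' ⊂ V, 2 ≤ V'.card → (spans E V').card ≤ 2 * V'.card - 3

/-- A Laman graph on vertex set `V`: a simple graph with `|V| ≥ 2`, exactly
`2|V| - 3` edges, in which every `V' ⊆ V` with `|V'| ≥ 2` spans at most `2|V'| - 3`
edges, and every vertex of `V` is incident to at least one edge. -/
def IsLaman (V : Finset ℕ) (E : Finset (Sym2 ℕ)) : Prop :=
  IsGraph V E ∧ 2 ≤ V.card ∧ E.card = 2 * V.card - 3 ∧
    (∀ V' ⊆ V, 2 ≤ V'.card → (spans E V').card ≤ 2 * V'.card - 3) ∧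
    ∀ v ∈ V, ∃ e ∈ E, v ∈ e

theorem spans_mono_left {E F : Finset (Sym2 ℕ)} (h : E ⊆ F) (W : Finset ℕ) :
    spans E W ⊆ spans F W :=
  Finset.filter_subset_filter _ h

theorem IsGraph.two_le_card {V : Finset ℕ} {E : Finset (Sym2 ℕ)} (h : IsGraph V E)
    {e : Sym2 ℕ} (he : e ∈ E) : 2 ≤ V.card := by
  induction e using Sym2.ind with
  | h a b =>
    obtain ⟨hab, hmem⟩ := h _ he
    exact Finset.one_lt_card.mpr
      ⟨a, hmem a (Sym2.mem_mk_left a b), b, hmem b (Sym2.mem_mk_right a b),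
        fun hne => hab (Sym2.mk_isDiag_iff.mpr hne)⟩

/-- If the edge count of a nonempty graph is tight and every subset satisfies the sparsity bound,
then no vertex is isolated. -/
theorem IsGraph.exists_mem_edge_of_tight {V : Finset ℕ} {E : Finset (Sym2 ℕ)} (h : IsGraph V E)
    {e : Sym2 ℕ} (he : e ∈ E) (hcard : E.card = 2 * V.card - 3)
    (hsparse : ∀ V' ⊆ V, 2 ≤ V'.card → (spans E V').card ≤ 2 * V'.card - 3)
    {v : ℕ} (hv : v ∈ V) : ∃ f ∈ E, v ∈ f := by
  by_contra! hiso
  have hgraph : IsGraph (V.erase v) E := fun f hf =>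
    ⟨(h f hf).1, fun w hw =>
      Finset.mem_erase.mpr ⟨fun hwv => hiso f hf (hwv ▸ hw), (h f hf).2 w hw⟩⟩
  have hspans : spans E (V.erase v) = E :=
    Finset.filter_true_of_mem fun f hf => (hgraph f hf).2
  have htwo := hgraph.two_le_card he
  have hle := hsparse _ (Finset.erase_subset v V) htwo
  rw [hspans] at hle
  have := Finset.card_erase_add_one hv
  omega

/-- If a rigidity circuit is the combinatorial resultant of two rigidity circuits,
each with fewer vertices, then the common part of the two circuits is a Laman graph;
in particular it has exactly `2|V1 ∩ V2| - 3` edges. -/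
theorem common_part_of_CRD_is_laman (V V1 V2 : Finset ℕ)
    (E E1 E2 : Finset (Sym2 ℕ)) (e : Sym2 ℕ)
    (hG : IsRigidityCircuit V E)
    (h1 : IsRigidityCircuit V1 E1) (h2 : IsRigidityCircuit V2 E2)
    (he : e ∈ E1 ∩ E2)
    (hV : V = V1 ∪ V2) (hE : E = (E1 ∪ E2) \ {e})
    (hc1 : V1.card < V.card) (hc2 : V2.card < V.card) :
    IsLaman (V1 ∩ V2) (E1 ∩ E2) ∧ (E1 ∩ E2).card = 2 * (V1 ∩ V2).card - 3 := by
  subst hV hE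
  obtain ⟨-, hGcard, -⟩ := hG
  obtain ⟨hg1, hcard1, hsparse1⟩ := h1
  obtain ⟨hg2, hcard2, -⟩ := h2
  have he1 := (Finset.mem_inter.mp he).1
  have he2 := (Finset.mem_inter.mp he).2
  have hgraph : IsGraph (V1 ∩ V2) (E1 ∩ E2) := fun f hf =>
    ⟨(hg1 f (Finset.mem_inter.mp hf).1).1, fun v hv =>
      Finset.mem_inter.mpr ⟨(hg1 f (Finset.mem_inter.mp hf).1).2 v hv,
        (hg2 f (Finset.mem_inter.mp hf).2).2 v hv⟩⟩
  have htwo := hgraph.two_le_card he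
  have hcard : (E1 ∩ E2).card = 2 * (V1 ∩ V2).card - 3 := by
    have hVc := Finset.card_union_add_card_inter V1 V2
    have hEc := Finset.card_union_add_card_inter E1 E2
    have hpos : 0 < (E1 ∪ E2).card :=
      Finset.card_pos.mpr ⟨e, Finset.mem_union_left _ he1⟩
    rw [Finset.sdiff_singleton_eq_erase,
      Finset.card_erase_of_mem (Finset.mem_union_left _ he1)] at hGcard
    have := hg1.two_le_card he1
    have := hg2.two_le_card he2
    omega
  have hssub : V1 ∩ V2 ⊂ V1 := by
    refine Finset.inter_subset_left.ssubset_of_ne fun heq => ?_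
    rw [Finset.union_eq_right.mpr (Finset.inter_eq_left.mp heq)] at hc2
    exact lt_irrefl _ hc2
  have hsparse : ∀ V' ⊆ V1 ∩ V2, 2 ≤ V'.card →
      (spans (E1 ∩ E2) V').card ≤ 2 * V'.card - 3 := fun V' hV' h2V' =>
    (Finset.card_le_card (spans_mono_left Finset.inter_subset_left V')).trans
      (hsparse1 V' (hV'.trans_ssubset hssub) h2V')
  exact ⟨⟨hgraph, htwo, hcard, hsparse,
    fun _ hv => hgraph.exists_mem_edge_of_tight he hcard hsparse hv⟩, hcard⟩

end
end

section
/- Let G = (V, E) be a 3-connected rigidity circuit with |V| ≥ 5. Then G has an admissible pair: there exists a vertex v of degree exactly 3 in G and a non-edge e = {a, b} of G with both endpoints a, b in the neighbourhood N(v), such that the graph G − v + e, obtained by deleting v and its incident edges and adding the edge e, is a 3-connected rigidity circuit. -/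
open scoped Classical

noncomputable section

/-- The graph `(V, E)` is connected: `V` is nonempty and any two vertices of `V`
are joined by a walk along edges of `E`. -/
def ConnectedGraph (V : Finset ℕ) (E : Finset (Sym2 ℕ)) : Prop :=
  V.Nonempty ∧ ∀ a ∈ V, ∀ b ∈ V, Relation.ReflTransGen (fun x y => s(x, y) ∈ E) a b

/-- The graph `(V, E)` is 3-connected: it has at least 4 vertices and deleting any
at most 2 vertices (with all incident edges) leaves a connected graph. -/
def ThreeConnected (V : Finset ℕ) (E : Finset (Sym2 ℕ)) : Prop :=
  4 ≤ V.card ∧ ∀ S ⊆ V, S.card ≤ 2 → ConnectedGraph (V \ S) (spans E (V \ S))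

namespace RigidityCircuit

/-- The number of edges of `E` spanned by `X`. -/
def num (E : Finset (Sym2 ℕ)) (X : Finset ℕ) : ℕ := (spans E X).card

/-- The number of neighbours of `v` in `X`. -/
def dg (E : Finset (Sym2 ℕ)) (v : ℕ) (X : Finset ℕ) : ℕ := (X.filter (fun w => s(v, w) ∈ E)).card

/-- The edge set of the graph obtained by deleting `t` and adding the edge `pq`. -/
def reduce (E : Finset (Sym2 ℕ)) (t p q : ℕ) : Finset (Sym2 ℕ) :=
  E.filter (fun e => t ∉ e) ∪ {s(p, q)}

/-- `(R, S)` is a separation of `(V, E)` of order at most two. -/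
structure Sep (V : Finset ℕ) (E : Finset (Sym2 ℕ)) (R S : Finset ℕ) : Prop where
  union : R ∪ S = V
  inter : (R ∩ S).card ≤ 2
  left : ∃ x ∈ R, x ∉ S
  right : ∃ x ∈ S, x ∉ R
  edge : ∀ x y, s(x, y) ∈ E → (x ∈ R ∧ y ∈ R) ∨ (x ∈ S ∧ y ∈ S)

/-- A critical set: a set of at least two vertices spanning `2|X| - 3` edges. -/
structure Crit (V : Finset ℕ) (E : Finset (Sym2 ℕ)) (X : Finset ℕ) : Prop where
  sub : X ⊆ V
  two_le : 2 ≤ X.card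
  num_eq : num E X + 3 = 2 * X.card

/-- `v` is a vertex whose neighbours are exactly the three distinct vertices `a`, `b`, `c`. -/
structure Node (E : Finset (Sym2 ℕ)) (v a b c : ℕ) : Prop where
  ab : a ≠ b
  ac : a ≠ c
  bc : b ≠ c
  va : s(v, a) ∈ E
  vb : s(v, b) ∈ E
  vc : s(v, c) ∈ E
  eq : ∀ w, s(v, w) ∈ E → w = a ∨ w = b ∨ w = c

/-- The pair `a, b` of neighbours of the node `t` (with third neighbour `c`) is not blocked by
a critical set. -/
def Adm (V : Finset ℕ) (E : Finset (Sym2 ℕ)) (t a b c : ℕ) : Prop :=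
  ∀ Y, Crit V E Y → a ∈ Y → b ∈ Y → t ∉ Y → c ∈ Y

variable {V X Y Z R S : Finset ℕ} {E : Finset (Sym2 ℕ)} {t u v x y a b c : ℕ}

theorem Sep.symm (h : Sep V E R S) : Sep V E S R :=
  ⟨by rw [Finset.union_comm, h.union], by rw [Finset.inter_comm]; exact h.inter, h.right, h.left,
    fun x y hxy => (h.edge x y hxy).symm⟩

theorem Node.swap₁₂ (h : Node E v a b c) : Node E v b a c :=
  ⟨h.ab.symm, h.bc, h.ac, h.vb, h.va, h.vc, fun w hw => by have := h.eq w hw; tauto⟩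

theorem Node.swap₂₃ (h : Node E v a b c) : Node E v a c b :=
  ⟨h.ac, h.ab, h.bc.symm, h.va, h.vc, h.vb, fun w hw => by have := h.eq w hw; tauto⟩

theorem Adm.swap (h : Adm V E t a b c) : Adm V E t b a c :=
  fun Y hY hb ha ht => h Y hY ha hb ht

theorem mem_spans : s(x, y) ∈ spans E X ↔ s(x, y) ∈ E ∧ x ∈ X ∧ y ∈ X := by
  simp [spans]

theorem mem_reduce {p q : ℕ} :
    s(x, y) ∈ reduce E t p q ↔ (s(x, y) ∈ E ∧ t ≠ x ∧ t ≠ y) ∨ s(x, y) = s(p, q) := by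
  simp only [reduce, Finset.mem_union, Finset.mem_filter, Finset.mem_singleton, Sym2.mem_iff]
  tauto

theorem spans_mono (h : X ⊆ Y) : spans E X ⊆ spans E Y := by
  intro e
  induction e with | _ x y
  simp only [mem_spans]
  exact fun ⟨h1, h2, h3⟩ => ⟨h1, h h2, h h3⟩

theorem dg_mono (h : X ⊆ Y) : dg E v X ≤ dg E v Y :=
  Finset.card_le_card (Finset.filter_subset_filter _ h)

theorem dg_union_disjoint (h : Disjoint X Y) : dg E v (X ∪ Y) = dg E v X + dg E v Y := by
  unfold dg
  rw [Finset.filter_union, Finset.card_union_of_disjoint]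
  exact Finset.disjoint_filter_filter h

theorem spans_inter : spans E X ∩ spans E Y = spans E (X ∩ Y) := by
  ext e
  induction e with | _ x y
  simp only [Finset.mem_inter, mem_spans]
  tauto

theorem num_add_num_le : num E X + num E Y ≤ num E (X ∪ Y) + num E (X ∩ Y) := by
  unfold num
  rw [← Finset.card_union_add_card_inter, spans_inter]
  gcongr
  exact Finset.union_subset (spans_mono Finset.subset_union_left)
    (spans_mono Finset.subset_union_right)

theorem num_add_num_lt (hx : x ∈ X) (hxY : x ∉ Y) (hy : y ∈ Y) (hyX : y ∉ X)
    (hxy : s(x, y) ∈ E) : num E X + num E Y < num E (X ∪ Y) + num E (X ∩ Y) := by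
  unfold num
  rw [← Finset.card_union_add_card_inter, spans_inter]
  gcongr
  refine (Finset.ssubset_iff_of_subset ?_).2 ⟨s(x, y), ?_, ?_⟩
  · exact Finset.union_subset (spans_mono Finset.subset_union_left)
      (spans_mono Finset.subset_union_right)
  · simp [mem_spans, *]
  · simp [mem_spans, *]

theorem num_add_num_eq
    (h : ∀ x ∈ X ∪ Y, ∀ y ∈ X ∪ Y, s(x, y) ∈ E → (x ∈ X ∧ y ∈ X) ∨ (x ∈ Y ∧ y ∈ Y)) :
    num E X + num E Y = num E (X ∪ Y) + num E (X ∩ Y) := by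
  unfold num
  rw [← Finset.card_union_add_card_inter, spans_inter]
  congr 2
  ext e
  induction e with | _ x y
  have := h x
  have := h y
  simp only [Finset.mem_union, mem_spans] at *
  grind

theorem num_insert (hv : v ∉ X) (hE : s(v, v) ∉ E) :
    num E (insert v X) = num E X + dg E v X := by
  have h : spans E (insert v X) =
      spans E X ∪ (X.filter (fun w => s(v, w) ∈ E)).image (fun w => s(v, w)) := by
    ext e
    induction e with | _ x y
    simp only [Finset.mem_union, mem_spans, Finset.mem_image, Finset.mem_filter, Finset.mem_insert,
      Sym2.eq_iff]
    constructor
    · rintro ⟨h1, rfl | h2, rfl | h3⟩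
      · exact absurd h1 hE
      · exact Or.inr ⟨y, ⟨h3, h1⟩, by simp⟩
      · exact Or.inr ⟨x, ⟨h2, by rwa [Sym2.eq_swap]⟩, by simp⟩
      · exact Or.inl ⟨h1, h2, h3⟩
    · rintro (⟨h1, h2, h3⟩ | ⟨w, ⟨hw, hvw⟩, (⟨rfl, rfl⟩ | ⟨rfl, rfl⟩)⟩)
      · exact ⟨h1, Or.inr h2, Or.inr h3⟩
      · exact ⟨hvw, Or.inl rfl, Or.inr hw⟩
      · exact ⟨by rwa [Sym2.eq_swap], Or.inr hw, Or.inl rfl⟩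
  unfold num dg
  rw [h, Finset.card_union_of_disjoint, Finset.card_image_of_injective]
  · intro w w' hw
    exact Sym2.congr_right.1 hw
  · rw [Finset.disjoint_left]
    intro e he he'
    obtain ⟨w, -, rfl⟩ := Finset.mem_image.1 he'
    exact hv (mem_spans.1 he).2.1

theorem dg_pos (h : 0 < dg E v X) : ∃ w ∈ X, s(v, w) ∈ E := by
  obtain ⟨w, hw⟩ := Finset.card_pos.1 h
  exact ⟨w, Finset.mem_filter.1 hw⟩

theorem dg_one_lt (h : 1 < dg E v X) (u : ℕ) : ∃ w ∈ X, w ≠ u ∧ s(v, w) ∈ E := by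
  obtain ⟨w, hw, hwu⟩ := Finset.exists_mem_ne h u
  exact ⟨w, (Finset.mem_filter.1 hw).1, hwu, (Finset.mem_filter.1 hw).2⟩

theorem dg_le_one (h : dg E v X ≤ 1) {w w' : ℕ} (hw : w ∈ X) (hw' : w' ∈ X)
    (h1 : s(v, w) ∈ E) (h2 : s(v, w') ∈ E) : w = w' :=
  Finset.card_le_one.1 h w (by simp [*]) w' (by simp [*])

theorem dg_sub {W : Finset ℕ} (h : ∀ w ∈ X, s(v, w) ∈ E → w ∈ W) : dg E v X ≤ dg E v W :=
  Finset.card_le_card fun w hw => by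
    simp only [Finset.mem_filter] at *
    exact ⟨h w hw.1 hw.2, hw.2⟩

theorem num_eq_zero_of_card_le_one (hE : ∀ v, s(v, v) ∉ E) (h : X.card ≤ 1) : num E X = 0 := by
  unfold num
  rw [Finset.card_eq_zero, Finset.eq_empty_iff_forall_notMem]
  intro e
  induction e with | _ x y
  rw [mem_spans]
  rintro ⟨h1, hx, hy⟩
  rw [Finset.card_le_one.1 h x hx y hy] at h1
  exact hE _ h1

theorem sum_dg (hE : ∀ v, s(v, v) ∉ E) {W : Finset ℕ} (hW : W ⊆ Z) :
    ∑ v ∈ W, dg E v Z + num E (Z \ W) = num E Z + num E W := by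
  induction W using Finset.induction_on with
  | empty => simp [num_eq_zero_of_card_le_one hE (X := (∅ : Finset ℕ)) (by simp)]
  | insert w W hw ih =>
    have hwZ : w ∈ Z := hW (Finset.mem_insert_self _ _)
    have hWZ : W ⊆ Z := fun x hx => hW (Finset.mem_insert_of_mem hx)
    have ih := ih hWZ
    rw [Finset.sum_insert hw, num_insert hw (hE w)]
    have h1 : Z \ W = insert w (Z \ insert w W) := by
      ext x
      simp only [Finset.mem_sdiff, Finset.mem_insert]
      grind
    rw [h1, num_insert (by simp) (hE w)] at ih
    have h2 : dg E w Z = dg E w W + dg E w (Z \ insert w W) := by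
      rw [← dg_union_disjoint]
      · apply le_antisymm
        · apply dg_sub
          intro x hx hxw
          have : x ≠ w := by rintro rfl; exact hE _ hxw
          simp only [Finset.mem_union, Finset.mem_sdiff, Finset.mem_insert]
          tauto
        · apply dg_mono
          exact Finset.union_subset hWZ Finset.sdiff_subset
      · rw [Finset.disjoint_left]
        simp +contextual
    omega

theorem num_pair (hE : ∀ v, s(v, v) ∉ E) (h : s(a, b) ∈ E) : num E {a, b} = 1 := by
  have hab : a ≠ b := by rintro rfl; exact hE _ h
  rw [num_insert (by simpa using hab) (hE a), num_eq_zero_of_card_le_one hE (by simp)]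
  simp [dg, Finset.filter_singleton, h]

theorem edge_of_num_pos (hE : ∀ v, s(v, v) ∉ E) (hX : X.card ≤ 2) (h : 0 < num E X)
    (ha : a ∈ X) (hb : b ∈ X) (hab : a ≠ b) : s(a, b) ∈ E := by
  obtain ⟨e, he⟩ := Finset.card_pos.1 h
  induction e with | _ x y
  obtain ⟨hxy, hx, hy⟩ := mem_spans.1 he
  have hXe : X = {a, b} := by
    symm
    apply Finset.eq_of_subset_of_card_le
    · grind
    · rw [Finset.card_pair hab]; exact hX
  have : x ≠ y := by rintro rfl; exact hE _ hxy
  rw [hXe] at hx hy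
  simp only [Finset.mem_insert, Finset.mem_singleton] at hx hy
  rcases hx with rfl | rfl <;> rcases hy with rfl | rfl
  · exact absurd rfl this
  · exact hxy
  · rwa [Sym2.eq_swap]
  · exact absurd rfl this

theorem Node.dg_eq (h : Node E v a b c) (ha : a ∈ X) (hb : b ∈ X) (hc : c ∈ X) :
    dg E v X = 3 := by
  have : X.filter (fun w => s(v, w) ∈ E) = {a, b, c} := by
    ext w
    simp only [Finset.mem_filter, Finset.mem_insert, Finset.mem_singleton]
    constructor
    · exact fun hw => h.eq w hw.2
    · have := h.va
      have := h.vb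
      have := h.vc
      rintro (rfl | rfl | rfl) <;> tauto
  rw [dg, this, Finset.card_eq_three]
  exact ⟨a, b, c, h.ab, h.ac, h.bc, rfl⟩

theorem loopless (hG : IsRigidityCircuit V E) (v : ℕ) : s(v, v) ∉ E :=
  fun h => (hG.1 _ h).1 rfl

theorem mem_left (hG : IsRigidityCircuit V E) (h : s(x, y) ∈ E) : x ∈ V :=
  (hG.1 _ h).2 x (by simp)

theorem mem_right (hG : IsRigidityCircuit V E) (h : s(x, y) ∈ E) : y ∈ V :=
  (hG.1 _ h).2 y (by simp)

theorem num_univ (hG : IsRigidityCircuit V E) (hV : 1 ≤ V.card) : num E V + 2 = 2 * V.card := by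
  have h : spans E V = E := by
    ext e
    induction e with | _ x y
    rw [mem_spans]
    exact ⟨fun h => h.1, fun h => ⟨h, mem_left hG h, mem_right hG h⟩⟩
  have := hG.2.1
  rw [num, h]
  omega

theorem num_le (hG : IsRigidityCircuit V E) (hX : X ⊆ V) (hne : X ≠ V) (h2 : 2 ≤ X.card) :
    num E X + 3 ≤ 2 * X.card := by
  have := hG.2.2 X (hX.ssubset_of_ne hne) h2
  unfold num
  omega

theorem num_le_of_nonempty (hG : IsRigidityCircuit V E) (hX : X ⊆ V) (h1 : 1 ≤ X.card) :
    num E X + 2 ≤ 2 * X.card := by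
  rcases eq_or_ne X V with rfl | hne
  · exact (num_univ hG h1).le
  · rcases h1.lt_or_eq with h | h
    · have := num_le hG hX hne h
      omega
    · rw [num_eq_zero_of_card_le_one (loopless hG) h.ge]
      omega

theorem three_le_dg (hG : IsRigidityCircuit V E) (hV : 3 ≤ V.card) (hv : v ∈ V) :
    3 ≤ dg E v V := by
  have h1 := num_insert (Finset.notMem_erase v V) (loopless hG v)
  rw [Finset.insert_erase hv] at h1
  have h2 := Finset.card_erase_of_mem hv
  have h3 := num_le hG (Finset.erase_subset v V)
    (fun h => by rw [Finset.erase_eq_self] at h; exact h hv) (by omega)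
  have h4 := num_univ hG (by omega)
  have h5 : dg E v V = dg E v (V.erase v) := by
    apply le_antisymm
    · apply dg_sub
      intro w hw hvw
      refine Finset.mem_erase.2 ⟨?_, hw⟩
      rintro rfl
      exact loopless hG _ hvw
    · exact dg_mono (Finset.erase_subset v V)
  omega

theorem dg_erase (hE : ∀ v, s(v, v) ∉ E) : dg E v (X.erase v) = dg E v X := by
  apply le_antisymm
  · exact dg_mono (Finset.erase_subset v X)
  · apply dg_sub
    intro w hw hvw
    refine Finset.mem_erase.2 ⟨?_, hw⟩
    rintro rfl
    exact hE _ hvw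

theorem Crit.ne (hX : Crit V E X) (hG : IsRigidityCircuit V E) : X ≠ V := by
  rintro rfl
  have h1 := hX.two_le
  have h2 := hX.num_eq
  have h3 := num_univ hG (by omega)
  omega

theorem Crit.one_le_dg (hX : Crit V E X) (hG : IsRigidityCircuit V E) (hx : x ∈ X) :
    1 ≤ dg E x X := by
  have h1 := num_insert (Finset.notMem_erase x X) (loopless hG x)
  rw [Finset.insert_erase hx, dg_erase (loopless hG)] at h1
  have h2 := Finset.card_erase_of_mem hx
  have h3 := hX.two_le
  have h4 := num_le_of_nonempty hG ((Finset.erase_subset x X).trans hX.sub) (by omega)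
  have h5 := hX.num_eq
  omega

theorem Crit.two_le_dg (hX : Crit V E X) (hG : IsRigidityCircuit V E) (h3 : 3 ≤ X.card)
    (hx : x ∈ X) : 2 ≤ dg E x X := by
  have h1 := num_insert (Finset.notMem_erase x X) (loopless hG x)
  rw [Finset.insert_erase hx, dg_erase (loopless hG)] at h1
  have h2 := Finset.card_erase_of_mem hx
  have h4 := num_le hG ((Finset.erase_subset x X).trans hX.sub)
    (fun h => by
      have := Finset.card_le_card hX.sub
      have := Finset.card_pos.2 ⟨x, hx⟩
      rw [h] at h2
      omega) (by omega)
  have h5 := hX.num_eq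
  omega

theorem Crit.union (hX : Crit V E X) (hY : Crit V E Y) (hG : IsRigidityCircuit V E)
    (h2 : 2 ≤ (X ∩ Y).card) (hne : X ∪ Y ≠ V) :
    Crit V E (X ∪ Y) ∧ ∀ x ∈ X, x ∉ Y → ∀ y ∈ Y, y ∉ X → s(x, y) ∉ E := by
  have hsub : X ∪ Y ⊆ V := Finset.union_subset hX.sub hY.sub
  have hc := Finset.card_union_add_card_inter X Y
  have h3 := Finset.card_le_card (Finset.inter_subset_union (s := X) (t := Y))
  have h4 := num_le hG hsub hne (by omega)
  have h5 := num_le hG (Finset.inter_subset_left.trans hX.sub)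
    (fun h => hX.ne hG (hX.sub.antisymm (h ▸ Finset.inter_subset_left))) h2
  have h6 := hX.num_eq
  have h7 := hY.num_eq
  have h8 := num_add_num_le (E := E) (X := X) (Y := Y)
  refine ⟨⟨hsub, by omega, by omega⟩, ?_⟩
  intro x hx hxY y hy hyX hxy
  have h9 := num_add_num_lt hx hxY hy hyX hxy
  omega

theorem Node.mem (h : Node E t a b c) (hG : IsRigidityCircuit V E) :
    t ∈ V ∧ a ∈ V ∧ b ∈ V ∧ c ∈ V :=
  ⟨mem_left hG h.va, mem_right hG h.va, mem_right hG h.vb, mem_right hG h.vc⟩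

theorem Node.ne (h : Node E t a b c) (hG : IsRigidityCircuit V E) :
    t ≠ a ∧ t ≠ b ∧ t ≠ c :=
  ⟨by rintro rfl; exact loopless hG _ h.va, by rintro rfl; exact loopless hG _ h.vb,
    by rintro rfl; exact loopless hG _ h.vc⟩

theorem Node.eq_of_crit (h : Node E t a b c) (hG : IsRigidityCircuit V E) (hY : Crit V E Y)
    (ht : t ∉ Y) (ha : a ∈ Y) (hb : b ∈ Y) (hc : c ∈ Y) : Y = V \ {t} := by
  have h1 := num_insert ht (loopless hG t)
  rw [h.dg_eq ha hb hc] at h1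
  have h2 := hY.num_eq
  have h3 := Finset.card_insert_of_notMem ht
  have h4 : insert t Y = V := by
    by_contra hne
    have := num_le hG (Finset.insert_subset (h.mem hG).1 hY.sub) hne (by omega)
    omega
  rw [← h4]
  ext x
  simp only [Finset.mem_sdiff, Finset.mem_insert, Finset.mem_singleton]
  constructor
  · intro hx
    exact ⟨Or.inr hx, by rintro rfl; exact ht hx⟩
  · tauto

theorem Node.cover (h : Node E t a b c) (hG : IsRigidityCircuit V E) (hX : Crit V E X)
    (hY : Crit V E Y) (htX : t ∉ X) (htY : t ∉ Y) (h2 : 2 ≤ (X ∩ Y).card)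
    (ha : a ∈ X ∪ Y) (hb : b ∈ X ∪ Y) (hc : c ∈ X ∪ Y) :
    X ∪ Y = V \ {t} ∧ ∀ x ∈ X, x ∉ Y → ∀ y ∈ Y, y ∉ X → s(x, y) ∉ E := by
  have ht : t ∉ X ∪ Y := by simp [htX, htY]
  obtain ⟨h3, h4⟩ := hX.union hY hG h2 (fun h5 => ht (h5 ▸ (h.mem hG).1))
  exact ⟨h.eq_of_crit hG h3 ht ha hb hc, h4⟩

theorem crit_pair (hG : IsRigidityCircuit V E) (h : s(a, b) ∈ E) : Crit V E {a, b} := by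
  have hab : a ≠ b := by rintro rfl; exact loopless hG _ h
  have h2 := Finset.card_pair hab
  refine ⟨?_, h2.ge, by rw [num_pair (loopless hG) h, h2]⟩
  have := mem_left hG h
  have := mem_right hG h
  grind

theorem Sep.spec (h : Sep V E R S) (hG : IsRigidityCircuit V E) (hV : 3 ≤ V.card) :
    Crit V E R ∧ Crit V E S ∧ 3 ≤ R.card ∧ 3 ≤ S.card ∧ (R ∩ S).card = 2 ∧
      ∀ c ∈ R ∩ S, ∀ d ∈ R ∩ S, s(c, d) ∉ E := by
  have hc := Finset.card_union_add_card_inter R S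
  rw [h.union] at hc
  have h2 := h.inter
  obtain ⟨x, hxR, hxS⟩ := h.left
  obtain ⟨y, hyS, hyR⟩ := h.right
  have hR : R ⊆ V := h.union ▸ Finset.subset_union_left
  have hS : S ⊆ V := h.union ▸ Finset.subset_union_right
  have hRV : R ≠ V := fun h => hyR (h ▸ hS hyS)
  have hSV : S ≠ V := fun h => hxS (h ▸ hR hxR)
  have hn := num_add_num_eq (E := E) (X := R) (Y := S) (fun x _ y _ => h.edge x y)
  rw [h.union] at hn
  have hnV := num_univ hG (by omega)
  have hR1 := Finset.card_pos.2 ⟨x, hxR⟩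
  have hS1 := Finset.card_pos.2 ⟨y, hyS⟩
  have hlR : (R ∩ S).card < R.card := Finset.card_lt_card
    ((Finset.ssubset_iff_of_subset Finset.inter_subset_left).2 ⟨x, hxR, by simp [hxS]⟩)
  have hlS : (R ∩ S).card < S.card := Finset.card_lt_card
    ((Finset.ssubset_iff_of_subset Finset.inter_subset_right).2 ⟨y, hyS, by simp [hyR]⟩)
  have hz := num_le_of_nonempty hG hR hR1
  have hz' := num_le_of_nonempty hG hS hS1
  have hR2 : 2 ≤ R.card := by
    by_contra hlt
    have := num_le hG hS hSV (by omega)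
    have := num_eq_zero_of_card_le_one (loopless hG) (X := R) (by omega)
    omega
  have hS2 : 2 ≤ S.card := by
    by_contra hlt
    have := num_le hG hR hRV (by omega)
    have := num_eq_zero_of_card_le_one (loopless hG) (X := S) (by omega)
    omega
  have h5 := num_le hG hR hRV hR2
  have h6 := num_le hG hS hSV hS2
  refine ⟨⟨hR, hR2, by omega⟩, ⟨hS, hS2, by omega⟩, by omega, by omega, by omega, ?_⟩
  intro c hc d hd hcd
  have : 0 < num E (R ∩ S) := Finset.card_pos.2 ⟨s(c, d), mem_spans.2 ⟨hcd, hc, hd⟩⟩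
  omega

theorem Sep.subset_or (h : Sep V E R S) (hG : IsRigidityCircuit V E) (hV : 3 ≤ V.card)
    (hX : Crit V E X) : X ⊆ R ∨ X ⊆ S ∨ R ⊆ X ∨ S ⊆ X := by
  obtain ⟨hR, hS, -, -, h2, hRS⟩ := h.spec hG hV
  by_contra! hcon
  obtain ⟨h3, h4, h5, h6⟩ := hcon
  have hXV := hX.sub
  have hXu : (X ∩ R) ∪ (X ∩ S) = X := by
    rw [← Finset.inter_union_distrib_left, h.union, Finset.inter_eq_left.2 hXV]
  have hXi : (X ∩ R) ∩ (X ∩ S) = X ∩ (R ∩ S) := by grind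
  have hc := Finset.card_union_add_card_inter (X ∩ R) (X ∩ S)
  have hn := num_add_num_eq (E := E) (X := X ∩ R) (Y := X ∩ S) (fun x hx y hy hxy => by
    have := h.edge x y hxy
    rw [hXu] at hx hy
    simp only [Finset.mem_inter]
    tauto)
  rw [hXu, hXi] at hc hn
  have h0 : num E (X ∩ (R ∩ S)) = 0 := by
    by_contra hne
    obtain ⟨e, he⟩ := Finset.card_pos.1 (Nat.pos_of_ne_zero hne)
    induction e with | _ x y
    rw [mem_spans] at he
    exact hRS x (Finset.mem_inter.1 he.2.1).2 y (Finset.mem_inter.1 he.2.2).2 he.1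
  have hXn := hX.num_eq
  have hle : (X ∩ (R ∩ S)).card ≤ 2 := h2 ▸ Finset.card_le_card Finset.inter_subset_right
  obtain ⟨x, hx, hxR⟩ := Finset.not_subset.1 h3
  obtain ⟨y, hy, hyS⟩ := Finset.not_subset.1 h4
  have hxS : x ∈ S := by
    have := hXV hx
    rw [← h.union, Finset.mem_union] at this
    tauto
  have hyR : y ∈ R := by
    have := hXV hy
    rw [← h.union, Finset.mem_union] at this
    tauto
  have hl1 : (X ∩ (R ∩ S)).card < (X ∩ R).card := Finset.card_lt_card
    ((Finset.ssubset_iff_of_subset (by grind)).2 ⟨y, by grind, by grind⟩)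
  have hl2 : (X ∩ (R ∩ S)).card < (X ∩ S).card := Finset.card_lt_card
    ((Finset.ssubset_iff_of_subset (by grind)).2 ⟨x, by grind, by grind⟩)
  have hs1 : X ∩ R ⊆ V := Finset.inter_subset_left.trans hXV
  have hs2 : X ∩ S ⊆ V := Finset.inter_subset_left.trans hXV
  have hb1 := num_le_of_nonempty hG hs1 (by omega)
  have hb2 := num_le_of_nonempty hG hs2 (by omega)
  have hn1 : X ∩ R ≠ V := fun h => hxR (by
    have : x ∈ X ∩ R := h ▸ hXV hx
    exact (Finset.mem_inter.1 this).2)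
  have hn2 : X ∩ S ≠ V := fun h => hyS (by
    have : y ∈ X ∩ S := h ▸ hXV hy
    exact (Finset.mem_inter.1 this).2)
  rcases Nat.lt_or_ge (X ∩ (R ∩ S)).card 1 with hk | hk
  · omega
  have hb1 := num_le hG hs1 hn1 (by omega)
  have hb2 := num_le hG hs2 hn2 (by omega)
  have hk : (X ∩ (R ∩ S)).card = 2 := by omega
  have hsub : R ∩ S ⊆ X := by
    have := Finset.eq_of_subset_of_card_le (Finset.inter_subset_right : X ∩ (R ∩ S) ⊆ _)
      (by omega)
    rw [← this]
    exact Finset.inter_subset_left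
  have key : ∀ R S : Finset ℕ, Sep V E R S → Crit V E S → R ∩ S ⊆ X → ¬ R ⊆ X →
      (R ∩ S).card = 2 → num E (R ∩ S) = 0 → 2 ≤ (X ∩ R).card → num E (X ∩ R) + 4 ≤ 2 * (X ∩ R).card := by
    intro R S h hS hsub h5 h2 h0 hge
    obtain ⟨r, hr, hrX⟩ := Finset.not_subset.1 h5
    have hi : (X ∩ R) ∩ S = R ∩ S := by
      rw [Finset.inter_assoc, Finset.inter_eq_right.2 hsub]
    have hc := Finset.card_union_add_card_inter (X ∩ R) S
    have hn := num_add_num_eq (E := E) (X := X ∩ R) (Y := S) (fun x hx y hy hxy => by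
      have h7 := h.edge x y hxy
      have h8 := @hsub x
      have h9 := @hsub y
      clear * - hx hy h7 h8 h9
      simp only [Finset.mem_inter, Finset.mem_union] at *
      tauto)
    rw [hi] at hc hn
    have hrS : r ∉ S := fun h => hrX (hsub (Finset.mem_inter.2 ⟨hr, h⟩))
    have := hS.num_eq
    have := hS.two_le
    have := Finset.card_le_card (Finset.subset_union_right : S ⊆ X ∩ R ∪ S)
    have hXR : X ∩ R ⊆ V := Finset.inter_subset_left.trans hXV
    have := num_le hG (Finset.union_subset hXR hS.sub)
      (fun h' => by
        have hrV : r ∈ V := h.union ▸ Finset.mem_union_left _ hr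
        rw [← h', Finset.mem_union, Finset.mem_inter] at hrV
        tauto) (by omega)
    omega
  have hi : X ∩ (R ∩ S) = R ∩ S := Finset.inter_eq_right.2 hsub
  rw [hi] at h0
  have k1 := key R S h hS hsub h5 h2 h0 (by omega)
  rw [Finset.inter_comm] at hsub h2 h0
  have k2 := key S R h.symm hR hsub h6 h2 h0 (by omega)
  omega

theorem num_eq_of_edge {F : Finset (Sym2 ℕ)} {p q : ℕ}
    (h : ∀ x ∈ X, ∀ y ∈ X, s(x, y) ∈ F ↔ s(x, y) ∈ E ∨ s(x, y) = s(p, q))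
    (hpq : ¬ (p ∈ X ∧ q ∈ X)) : num F X = num E X := by
  unfold num
  congr 1
  ext e
  induction e with | _ x y
  rw [mem_spans, mem_spans]
  constructor
  · rintro ⟨h1, hx, hy⟩
    rcases (h x hx y hy).1 h1 with h2 | h2
    · exact ⟨h2, hx, hy⟩
    · rw [Sym2.eq_iff] at h2
      rcases h2 with ⟨rfl, rfl⟩ | ⟨rfl, rfl⟩
      · exact absurd ⟨hx, hy⟩ hpq
      · exact absurd ⟨hy, hx⟩ hpq
  · rintro ⟨h1, hx, hy⟩
    exact ⟨(h x hx y hy).2 (Or.inl h1), hx, hy⟩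

theorem num_eq_of_edge_mem {F : Finset (Sym2 ℕ)} {p q : ℕ}
    (h : ∀ x ∈ X, ∀ y ∈ X, s(x, y) ∈ F ↔ s(x, y) ∈ E ∨ s(x, y) = s(p, q))
    (hE : s(p, q) ∉ E) (hp : p ∈ X) (hq : q ∈ X) : num F X = num E X + 1 := by
  unfold num
  have : spans F X = insert s(p, q) (spans E X) := by
    ext e
    induction e with | _ x y
    rw [Finset.mem_insert, mem_spans, mem_spans]
    constructor
    · rintro ⟨h1, hx, hy⟩
      rcases (h x hx y hy).1 h1 with h2 | h2
      · exact Or.inr ⟨h2, hx, hy⟩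
      · exact Or.inl h2
    · rintro (h1 | ⟨h1, hx, hy⟩)
      · have h2 := h1
        rw [Sym2.eq_iff] at h2
        rcases h2 with ⟨rfl, rfl⟩ | ⟨rfl, rfl⟩
        · exact ⟨(h _ hp _ hq).2 (Or.inr h1), hp, hq⟩
        · exact ⟨(h _ hq _ hp).2 (Or.inr h1), hq, hp⟩
      · exact ⟨(h x hx y hy).2 (Or.inl h1), hx, hy⟩
  rw [this, Finset.card_insert_of_notMem]
  rw [mem_spans]
  tauto

theorem reduce_iff {p q : ℕ} (ht : t ∉ X) : ∀ x ∈ X, ∀ y ∈ X,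
    s(x, y) ∈ reduce E t p q ↔ s(x, y) ∈ E ∨ s(x, y) = s(p, q) := by
  intro x hx y hy
  rw [mem_reduce]
  have : t ≠ x := by rintro rfl; exact ht hx
  have : t ≠ y := by rintro rfl; exact ht hy
  tauto

theorem Adm.notMem (h : Adm V E t a b c) (hN : Node E t a b c) (hG : IsRigidityCircuit V E) :
    s(a, b) ∉ E := by
  intro hab
  have h1 := hN.ne hG
  have h2 := h _ (crit_pair hG hab) (by simp) (by simp) (by simp [h1.1, h1.2.1])
  have := hN.ac
  have := hN.bc
  grind

theorem isRigidityCircuit_of (hloop : ∀ v, s(v, v) ∉ E) (hmem : ∀ x y, s(x, y) ∈ E → x ∈ V)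
    (hn : num E V + 2 = 2 * V.card)
    (hle : ∀ X ⊆ V, X ≠ V → 2 ≤ X.card → num E X + 3 ≤ 2 * X.card) : IsRigidityCircuit V E := by
  refine ⟨?_, ?_, ?_⟩
  · intro e
    induction e with | _ x y
    intro he
    refine ⟨?_, ?_⟩
    · rw [Sym2.mk_isDiag_iff]
      rintro rfl
      exact hloop _ he
    · intro v hv
      rcases Sym2.mem_iff.1 hv with rfl | rfl
      · exact hmem _ _ he
      · exact hmem _ x (by rwa [Sym2.eq_swap])
  · have : spans E V = E := by
      ext e
      induction e with | _ x y
      rw [mem_spans]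
      exact ⟨fun h => h.1, fun h => ⟨h, hmem _ _ h, hmem y x (by rwa [Sym2.eq_swap])⟩⟩
    rw [num, this] at hn
    omega
  · intro X hX h2
    have := hle X hX.1 hX.ne h2
    unfold num at this
    omega

theorem Adm.isRigidityCircuit (h : Adm V E t a b c) (hN : Node E t a b c)
    (hG : IsRigidityCircuit V E) : IsRigidityCircuit (V \ {t}) (reduce E t a b) := by
  obtain ⟨htV, haV, hbV, hcV⟩ := hN.mem hG
  obtain ⟨hta, htb, htc⟩ := hN.ne hG
  have hab := h.notMem hN hG
  have ht : t ∉ V \ {t} := by simp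
  have haV' : a ∈ V \ {t} := by simp [haV, hta.symm]
  have hbV' : b ∈ V \ {t} := by simp [hbV, htb.symm]
  have hcV' : c ∈ V \ {t} := by simp [hcV, htc.symm]
  have hins : insert t (V \ {t}) = V := by
    rw [← Finset.erase_eq, Finset.insert_erase htV]
  have hcard := Finset.card_insert_of_notMem ht
  have hnum := num_insert ht (loopless hG t)
  rw [hN.dg_eq haV' hbV' hcV', hins] at hnum
  rw [hins] at hcard
  apply isRigidityCircuit_of
  · intro v hv
    rw [mem_reduce, Sym2.eq_iff] at hv
    rcases hv with hv | hv
    · exact loopless hG _ hv.1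
    · have := hN.ab
      grind
  · intro x y hxy
    rw [mem_reduce, Sym2.eq_iff] at hxy
    rcases hxy with hxy | ⟨rfl, rfl⟩ | ⟨rfl, rfl⟩
    · simp only [Finset.mem_sdiff, Finset.mem_singleton]
      exact ⟨mem_left hG hxy.1, hxy.2.1.symm⟩
    · exact haV'
    · exact hbV'
  · rw [num_eq_of_edge_mem (reduce_iff ht) hab haV' hbV']
    have := num_univ hG (by omega)
    omega
  · intro X hX hne h2
    have htX : t ∉ X := fun h => ht (hX h)
    have hXV : X ⊆ V := hX.trans Finset.sdiff_subset
    have hle := num_le hG hXV (by rintro rfl; exact htX htV) h2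
    by_cases hm : a ∈ X ∧ b ∈ X
    · rw [num_eq_of_edge_mem (reduce_iff htX) hab hm.1 hm.2]
      by_contra hlt
      have hcr : Crit V E X := ⟨hXV, h2, by omega⟩
      exact hne (hN.eq_of_crit hG hcr htX hm.1 hm.2 (h X hcr hm.1 hm.2 htX))
    · rwa [num_eq_of_edge (reduce_iff htX) hm]

theorem ThreeConnected.not_sep (h : ThreeConnected V E) (R S : Finset ℕ) : ¬ Sep V E R S := by
  intro hS
  have hT : R ∩ S ⊆ V := by
    rw [← hS.union]
    exact Finset.inter_subset_union
  obtain ⟨-, hc⟩ := h.2 _ hT hS.inter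
  obtain ⟨x, hxR, hxS⟩ := hS.left
  obtain ⟨y, hyS, hyR⟩ := hS.right
  have hx : x ∈ V \ (R ∩ S) := by
    rw [← hS.union]
    simp [hxR, hxS]
  have hy : y ∈ V \ (R ∩ S) := by
    rw [← hS.union]
    simp [hyR, hyS]
  have hxy := hc x hx y hy
  have key : ∀ z, Relation.ReflTransGen (fun x y => s(x, y) ∈ spans E (V \ (R ∩ S))) x z →
      z ∈ R ∧ z ∉ S := by
    intro z hz
    induction hz with
    | refl => exact ⟨hxR, hxS⟩
    | tail _ hbc ih =>
      rw [mem_spans, Finset.mem_sdiff, Finset.mem_sdiff, Finset.mem_inter, Finset.mem_inter] at hbc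
      have := hS.edge _ _ hbc.1
      tauto
  exact hyR (key y hxy).1

theorem threeConnected_of_not_sep (hG : IsRigidityCircuit V E) (hV : 4 ≤ V.card)
    (h : ∀ R S, ¬ Sep V E R S) : ThreeConnected V E := by
  refine ⟨hV, fun T hT hT2 => ⟨?_, ?_⟩⟩
  · rw [← Finset.card_pos, Finset.card_sdiff_of_subset hT]
    omega
  intro a ha b hb
  by_contra hab
  let r : ℕ → ℕ → Prop := fun x y => s(x, y) ∈ spans E (V \ T)
  let W : Finset ℕ := (V \ T).filter (fun z => Relation.ReflTransGen r a z)
  have hW : ∀ z, z ∈ W ↔ (z ∈ V ∧ z ∉ T) ∧ Relation.ReflTransGen r a z := by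
    intro z
    simp [W]
  have haW : a ∈ W := (hW a).2 ⟨by simpa using ha, Relation.ReflTransGen.refl⟩
  have hbW : b ∉ W := fun h => hab ((hW b).1 h).2
  have hWV : ∀ z ∈ W, z ∈ V ∧ z ∉ T := fun z hz => ((hW z).1 hz).1
  have hstep : ∀ x y, s(x, y) ∈ E → x ∈ W → y ∈ W ∨ y ∈ T := by
    intro x y hxy hx
    by_cases hy : y ∈ T
    · exact Or.inr hy
    · refine Or.inl ((hW y).2 ⟨⟨mem_right hG hxy, hy⟩, ((hW x).1 hx).2.tail ?_⟩)
      have := hWV x hx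
      simp only [r, mem_spans, Finset.mem_sdiff]
      exact ⟨hxy, this, mem_right hG hxy, hy⟩
  rw [Finset.mem_sdiff] at ha hb
  refine h (W ∪ T) (V \ W) ⟨?_, ?_, ⟨a, by simp [haW], by simp [haW]⟩,
    ⟨b, by simp [hb.1, hbW], by simp [hbW, hb.2]⟩, ?_⟩
  · ext z
    have := hWV z
    have := @hT z
    simp only [Finset.mem_union, Finset.mem_sdiff]
    tauto
  · refine (Finset.card_le_card ?_).trans hT2
    intro z
    simp only [Finset.mem_union, Finset.mem_sdiff, Finset.mem_inter]
    tauto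
  · intro x y hxy
    have h1 := hstep x y hxy
    have h2 := hstep y x (by rwa [Sym2.eq_swap])
    have h3 := mem_left hG hxy
    have h4 := mem_right hG hxy
    simp only [Finset.mem_union, Finset.mem_sdiff]
    tauto

theorem Crit.not_cover (hX : Crit V E X) (hG : IsRigidityCircuit V E) {A B : Finset ℕ}
    (hA : (A ∩ X).card ≤ 1) (hB : (B ∩ X).card ≤ 1) (hsub : X ⊆ A ∪ B)
    (hno : ∀ x ∈ A, x ∉ B → ∀ y ∈ B, y ∉ A → s(x, y) ∉ E) : False := by
  have h1 : X.card ≤ 2 := by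
    calc X.card ≤ (A ∩ X ∪ B ∩ X).card := by
          apply Finset.card_le_card
          intro x hx
          have := hsub hx
          simp only [Finset.mem_union, Finset.mem_inter] at *
          tauto
      _ ≤ (A ∩ X).card + (B ∩ X).card := Finset.card_union_le _ _
      _ ≤ 2 := by omega
  have h2 := hX.num_eq
  have h3 := hX.two_le
  obtain ⟨p, q, hpq, rfl⟩ := Finset.card_eq_two.1 (le_antisymm h1 h3)
  have he := edge_of_num_pos (loopless hG) h1 (by omega) (a := p) (b := q) (by simp) (by simp) hpq
  have hA' : ¬ (p ∈ A ∧ q ∈ A) := fun h =>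
    hpq (Finset.card_le_one.1 hA p (by simp [h.1]) q (by simp [h.2]))
  have hB' : ¬ (p ∈ B ∧ q ∈ B) := fun h =>
    hpq (Finset.card_le_one.1 hB p (by simp [h.1]) q (by simp [h.2]))
  have hp := hsub (show p ∈ ({p, q} : Finset ℕ) by simp)
  have hq := hsub (show q ∈ ({p, q} : Finset ℕ) by simp)
  rw [Finset.mem_union] at hp hq
  have he' : s(q, p) ∈ E := by rwa [Sym2.eq_swap]
  by_cases hpA : p ∈ A
  · exact hno p hpA (by tauto) q (by tauto) (by tauto) he
  · exact hno q (by tauto) (by tauto) p (by tauto) (by tauto) he'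

theorem exists_node (h : dg E t V = 3) (hG : IsRigidityCircuit V E) :
    ∃ a b c, Node E t a b c := by
  obtain ⟨a, b, c, hab, hac, hbc, h⟩ := Finset.card_eq_three.1 h
  have hm : ∀ w, s(t, w) ∈ E ↔ w = a ∨ w = b ∨ w = c := by
    intro w
    have := Finset.ext_iff.1 h w
    simp only [Finset.mem_filter, Finset.mem_insert, Finset.mem_singleton] at this
    rw [← this]
    exact ⟨fun h => ⟨mem_right hG h, h⟩, fun h => h.2⟩
  exact ⟨a, b, c, hab, hac, hbc, by simp [hm], by simp [hm], by simp [hm], fun w => (hm w).1⟩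

theorem Node.two_le_inter (h : Node E t a b c) (hG : IsRigidityCircuit V E)
    (hS : ∀ R S, ¬ Sep V E R S) (hV : 5 ≤ V.card) (hd : dg E a V = 3) (hY : Crit V E Y)
    (hZ : Crit V E Z) (htY : t ∉ Y) (htZ : t ∉ Z) (haY : a ∈ Y) (hbY : b ∈ Y) (haZ : a ∈ Z)
    (hcZ : c ∈ Z) : 2 ≤ (Y ∩ Z).card := by
  by_contra hlt
  obtain ⟨htV, haV, hbV, hcV⟩ := h.mem hG
  obtain ⟨hta, htb, htc⟩ := h.ne hG
  have hYZ : ∀ x ∈ Y, x ∈ Z → x = a := fun x hx hx' =>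
    Finset.card_le_one.1 (by omega : (Y ∩ Z).card ≤ 1) x (by simp [hx, hx']) a (by simp [haY, haZ])
  have hat : s(a, t) ∈ E := by rw [Sym2.eq_swap]; exact h.va
  have h1 : dg E a ({t} ∪ (Y ∪ Z.erase a)) = dg E a {t} + (dg E a Y + dg E a Z) := by
    rw [dg_union_disjoint, dg_union_disjoint, dg_erase (loopless hG)]
    · rw [Finset.disjoint_left]
      intro x hx hx'
      rw [Finset.mem_erase] at hx'
      exact hx'.1 (hYZ x hx hx'.2)
    · simp [htY, htZ]
  have h2 : dg E a ({t} ∪ (Y ∪ Z.erase a)) ≤ dg E a V := by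
    apply dg_mono
    have := hY.sub
    have := hZ.sub
    have := (Finset.erase_subset a Z).trans hZ.sub
    exact Finset.union_subset (by simpa using htV) (Finset.union_subset hY.sub this)
  have h3 : dg E a {t} = 1 := by simp [dg, Finset.filter_singleton, hat]
  have h4 := hY.one_le_dg hG haY
  have h5 := hZ.one_le_dg hG haZ
  have h6 : Y.card ≤ 2 := by
    by_contra hc
    have := hY.two_le_dg hG (by omega) haY
    omega
  have h7 : Z.card ≤ 2 := by
    by_contra hc
    have := hZ.two_le_dg hG (by omega) haZ
    omega
  have hYn := hY.num_eq
  have hYt := hY.two_le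
  have hZn := hZ.num_eq
  have hZt := hZ.two_le
  have hab := edge_of_num_pos (loopless hG) h6 (by omega) haY hbY h.ab
  have hac := edge_of_num_pos (loopless hG) h7 (by omega) haZ hcZ h.ac
  have hN : ∀ w, s(a, w) ∈ E → w = t ∨ w = b ∨ w = c := by
    have h8 : ({t, b, c} : Finset ℕ) = V.filter (fun w => s(a, w) ∈ E) := by
      apply Finset.eq_of_subset_of_card_le
      · intro w
        simp only [Finset.mem_insert, Finset.mem_singleton, Finset.mem_filter]
        rintro (rfl | rfl | rfl) <;> tauto
      · rw [Finset.card_eq_three.2 ⟨t, b, c, htb, htc, h.bc, rfl⟩]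
        exact hd.le
    intro w hw
    have : w ∈ ({t, b, c} : Finset ℕ) := by
      rw [h8]
      simp [hw, mem_right hG hw]
    simpa using this
  have h9 : ({t, a, b, c} : Finset ℕ).card ≤ 4 := Finset.card_le_four
  obtain ⟨z, hz, hz'⟩ : ∃ z ∈ V, z ∉ ({t, a, b, c} : Finset ℕ) := by
    by_contra! hc
    have := Finset.card_le_card (show V ⊆ ({t, a, b, c} : Finset ℕ) from hc)
    omega
  simp only [Finset.mem_insert, Finset.mem_singleton, not_or] at hz'
  refine hS {t, a, b, c} (V \ {t, a}) ⟨?_, ?_, ⟨t, by simp, by simp⟩, ⟨z, ?_, ?_⟩, ?_⟩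
  · ext x
    simp only [Finset.mem_insert, Finset.mem_singleton, Finset.mem_union, Finset.mem_sdiff]
    constructor
    · rintro ((rfl | rfl | rfl | rfl) | hx)
      · exact htV
      · exact haV
      · exact hbV
      · exact hcV
      · exact hx.1
    · tauto
  · refine (Finset.card_le_card (t := {b, c}) ?_).trans Finset.card_le_two
    intro x
    simp only [Finset.mem_insert, Finset.mem_singleton, Finset.mem_inter, Finset.mem_sdiff]
    tauto
  · simp [hz, hz']
  · simp [hz']
  · intro x y hxy
    have e1 := mem_left hG hxy
    have e2 := mem_right hG hxy
    have hyx : s(y, x) ∈ E := by rwa [Sym2.eq_swap]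
    have f : ∀ x y, s(x, y) ∈ E → x = t ∨ x = a → y = t ∨ y = a ∨ y = b ∨ y = c := by
      rintro x y hxy (rfl | rfl)
      · exact Or.inr (h.eq y hxy)
      · rcases hN y hxy with h | h <;> simp [h]
    simp only [Finset.mem_insert, Finset.mem_singleton, Finset.mem_sdiff]
    by_cases hx : x = t ∨ x = a
    · exact Or.inl ⟨by rcases hx with h | h <;> simp [h], f x y hxy hx⟩
    · by_cases hy : y = t ∨ y = a
      · exact Or.inl ⟨f y x hyx hy, by rcases hy with h | h <;> simp [h]⟩
      · exact Or.inr ⟨⟨e1, hx⟩, ⟨e2, hy⟩⟩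

theorem Node.not_three_blocked (h : Node E t a b c) (hG : IsRigidityCircuit V E)
    (hS : ∀ R S, ¬ Sep V E R S) (hV : 5 ≤ V.card) {A B C : Finset ℕ} (hA : Crit V E A)
    (hB : Crit V E B) (hC : Crit V E C) (htA : t ∉ A) (htB : t ∉ B) (htC : t ∉ C) (hbA : b ∈ A)
    (hcA : c ∈ A) (haB : a ∈ B) (hcB : c ∈ B) (haC : a ∈ C) (hbC : b ∈ C)
    (hAB : (A ∩ B).card ≤ 1) (hAC : (A ∩ C).card ≤ 1) (hBC : (B ∩ C).card ≤ 1) : False := by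
  obtain ⟨htV, haV, hbV, hcV⟩ := h.mem hG
  have uAB : ∀ x ∈ A, x ∈ B → x = c := fun x hx hx' =>
    Finset.card_le_one.1 hAB x (by simp [hx, hx']) c (by simp [*])
  have uAC : ∀ x ∈ A, x ∈ C → x = b := fun x hx hx' =>
    Finset.card_le_one.1 hAC x (by simp [hx, hx']) b (by simp [*])
  have uBC : ∀ x ∈ B, x ∈ C → x = a := fun x hx hx' =>
    Finset.card_le_one.1 hBC x (by simp [hx, hx']) a (by simp [*])
  have cAB : (A ∩ B).card = 1 := le_antisymm hAB (Finset.card_pos.2 ⟨c, by simp [*]⟩)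
  have cABC : (A ∪ B) ∩ C = {a, b} := by
    ext x
    simp only [Finset.mem_inter, Finset.mem_union, Finset.mem_insert, Finset.mem_singleton]
    constructor
    · rintro ⟨h1 | h1, h2⟩
      · exact Or.inr (uAC x h1 h2)
      · exact Or.inl (uBC x h1 h2)
    · rintro (rfl | rfl) <;> tauto
  have k1 := Finset.card_union_add_card_inter A B
  have k2 := Finset.card_union_add_card_inter (A ∪ B) C
  rw [cABC, Finset.card_pair h.ab] at k2
  have hE := loopless hG
  have d1 : Disjoint (spans E A) (spans E B) := by
    rw [Finset.disjoint_iff_inter_eq_empty, spans_inter, ← Finset.card_eq_zero]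
    exact num_eq_zero_of_card_le_one hE hAB
  have d2 : Disjoint (spans E A) (spans E C) := by
    rw [Finset.disjoint_iff_inter_eq_empty, spans_inter, ← Finset.card_eq_zero]
    exact num_eq_zero_of_card_le_one hE hAC
  have d3 : Disjoint (spans E B) (spans E C) := by
    rw [Finset.disjoint_iff_inter_eq_empty, spans_inter, ← Finset.card_eq_zero]
    exact num_eq_zero_of_card_le_one hE hBC
  have hsub : spans E A ∪ spans E B ∪ spans E C ⊆ spans E (A ∪ B ∪ C) := by
    refine Finset.union_subset (Finset.union_subset (spans_mono ?_) (spans_mono ?_))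
      (spans_mono Finset.subset_union_right)
    · exact Finset.subset_union_left.trans Finset.subset_union_left
    · exact Finset.subset_union_right.trans Finset.subset_union_left
  have hcard : (spans E A ∪ spans E B ∪ spans E C).card = num E A + num E B + num E C := by
    rw [Finset.card_union_of_disjoint (Finset.disjoint_union_left.2 ⟨d2, d3⟩),
      Finset.card_union_of_disjoint d1]
    rfl
  have hUV : A ∪ B ∪ C ⊆ V := Finset.union_subset (Finset.union_subset hA.sub hB.sub) hC.sub
  have htU : t ∉ A ∪ B ∪ C := by simp [htA, htB, htC]
  have n1 := hA.num_eq
  have n2 := hB.num_eq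
  have n3 := hC.num_eq
  have m1 := hA.two_le
  have m2 := hB.two_le
  have m3 := hC.two_le
  have n4 := num_le hG hUV (fun h => htU (h ▸ htV)) (by omega)
  have n5 : num E A + num E B + num E C ≤ num E (A ∪ B ∪ C) := hcard ▸ Finset.card_le_card hsub
  have hU : Crit V E (A ∪ B ∪ C) := ⟨hUV, by omega, by omega⟩
  have hUeq := h.eq_of_crit hG hU htU (by simp [*]) (by simp [*]) (by simp [*])
  have hspan : spans E A ∪ spans E B ∪ spans E C = spans E (A ∪ B ∪ C) := by
    apply Finset.eq_of_subset_of_card_le hsub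
    rw [hcard]
    have := hU.num_eq
    unfold num at *
    omega
  have hmem : ∀ x, x ∈ V → x = t ∨ x ∈ A ∨ x ∈ B ∨ x ∈ C := by
    intro x hx
    by_cases hxt : x = t
    · exact Or.inl hxt
    · have : x ∈ A ∪ B ∪ C := by
        rw [hUeq]
        simp [hx, hxt]
      simp only [Finset.mem_union] at this
      tauto
  have hedge : ∀ x y, s(x, y) ∈ E → x ≠ t → y ≠ t →
      (x ∈ A ∧ y ∈ A) ∨ (x ∈ B ∧ y ∈ B) ∨ (x ∈ C ∧ y ∈ C) := by
    intro x y hxy hx hy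
    have : s(x, y) ∈ spans E (A ∪ B ∪ C) := by
      rw [mem_spans, hUeq]
      simp [hxy, hx, hy, mem_left hG hxy, mem_right hG hxy]
    rw [← hspan] at this
    simp only [Finset.mem_union, mem_spans] at this
    rcases this with (h | h) | h
    · exact Or.inl h.2
    · exact Or.inr (Or.inl h.2)
    · exact Or.inr (Or.inr h.2)
  have key : ∀ a b c A B C, Node E t a b c → b ∈ A → c ∈ A → a ∈ B → c ∈ B → a ∈ C → b ∈ C →
      (∀ x ∈ A, x ∈ B → x = c) → (∀ x ∈ A, x ∈ C → x = b) →
      t ∉ A → A ⊆ V → B ⊆ V → C ⊆ V →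
      (∀ x, x ∈ V → x = t ∨ x ∈ A ∨ x ∈ B ∨ x ∈ C) →
      (∀ x y, s(x, y) ∈ E → x ≠ t → y ≠ t →
        (x ∈ A ∧ y ∈ A) ∨ (x ∈ B ∧ y ∈ B) ∨ (x ∈ C ∧ y ∈ C)) → A.card ≤ 2 := by
    clear * - hS hG
    intro a b c A B C h hbA hcA haB hcB haC hbC uAB uAC htA hA hB hC hmem hedge
    by_contra hlt
    obtain ⟨z, hzA, hz⟩ : ∃ z ∈ A, z ∉ ({b, c} : Finset ℕ) := by
      by_contra! hc
      have := Finset.card_le_card (show A ⊆ ({b, c} : Finset ℕ) from hc)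
      have := Finset.card_le_two (a := b) (b := c)
      omega
    simp only [Finset.mem_insert, Finset.mem_singleton, not_or] at hz
    obtain ⟨htV, haV, hbV, hcV⟩ := h.mem hG
    refine hS A (B ∪ C ∪ {t}) ⟨?_, ?_, ⟨z, hzA, ?_⟩, ⟨t, by simp, htA⟩, ?_⟩
    · ext x
      simp only [Finset.mem_union, Finset.mem_singleton]
      constructor
      · rintro (hx | (hx | hx) | rfl)
        · exact hA hx
        · exact hB hx
        · exact hC hx
        · exact htV
      · intro hx
        rcases hmem x hx with h | h | h | h <;> simp [h]
    · refine (Finset.card_le_card (t := {b, c}) ?_).trans Finset.card_le_two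
      intro x
      simp only [Finset.mem_insert, Finset.mem_singleton, Finset.mem_inter, Finset.mem_union]
      rintro ⟨hx, (hx' | hx') | rfl⟩
      · exact Or.inr (uAB x hx hx')
      · exact Or.inl (uAC x hx hx')
      · exact absurd hx htA
    · simp only [Finset.mem_union, Finset.mem_singleton]
      rintro ((hx | hx) | rfl)
      · exact hz.2 (uAB z hzA hx)
      · exact hz.1 (uAC z hzA hx)
      · exact htA hzA
    · intro x y hxy
      have hyx : s(y, x) ∈ E := by rwa [Sym2.eq_swap]
      simp only [Finset.mem_union, Finset.mem_singleton]
      by_cases hx : x = t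
      · subst hx
        rcases h.eq y hxy with rfl | rfl | rfl <;> simp [*]
      · by_cases hy : y = t
        · subst hy
          rcases h.eq x hyx with rfl | rfl | rfl <;> simp [*]
        · rcases hedge x y hxy hx hy with h | h | h <;> simp [h]
  have r1 := key a b c A B C h hbA hcA haB hcB haC hbC uAB uAC htA hA.sub hB.sub hC.sub hmem hedge
  have r2 := key b a c B A C h.swap₁₂ haB hcB hbA hcA hbC haC (fun x h1 h2 => uAB x h2 h1) uBC htB
    hB.sub hA.sub hC.sub (fun x hx => by rcases hmem x hx with h | h | h | h <;> simp [h])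
    (fun x y hxy hx hy => by rcases hedge x y hxy hx hy with h | h | h <;> simp [h])
  have r3 := key c a b C A B h.swap₂₃.swap₁₂ haC hbC hcA hbA hcB haB (fun x h1 h2 => uAC x h2 h1)
    (fun x h1 h2 => uBC x h2 h1) htC hC.sub hA.sub hB.sub
    (fun x hx => by rcases hmem x hx with h | h | h | h <;> simp [h])
    (fun x y hxy hx hy => by rcases hedge x y hxy hx hy with h | h | h <;> simp [h])
  have hVc := Finset.card_sdiff_of_subset (Finset.singleton_subset_iff.2 htV)
  rw [← hUeq, Finset.card_singleton] at hVc
  omega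

theorem exists_adm_of_maximal (hG : IsRigidityCircuit V E) (hS : ∀ R S, ¬ Sep V E R S)
    (hV : 5 ≤ V.card) (hX : Crit V E X) {z : ℕ} (hz : z ∈ V) (hzX : z ∉ X) (hzd : 4 ≤ dg E z V)
    (hmax : ∀ X', Crit V E X' → X ⊆ X' → (∃ z ∈ V, z ∉ X' ∧ 4 ≤ dg E z V) → X' = X)
    (ht : t ∈ V) (htX : t ∉ X) (htd : dg E t V = 3)
    (hone : ∀ w w', s(t, w) ∈ E → s(t, w') ∈ E → w ∉ X → w' ∉ X → dg E w V = 3 →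
      dg E w' V = 3 → w = w') : ∃ a b c, Node E t a b c ∧ Adm V E t a b c := by
  by_contra! hno
  have hblock : ∀ a b c, Node E t a b c → ∃ Y, Crit V E Y ∧ a ∈ Y ∧ b ∈ Y ∧ t ∉ Y ∧ c ∉ Y := by
    intro a b c h
    have := hno a b c h
    unfold Adm at this
    push Not at this
    exact this
  have hX2 : ∀ a b c, Node E t a b c → a ∈ X → b ∈ X → False := by
    intro a b c h ha hb
    have hzt : z ≠ t := by rintro rfl; omega
    have hn := num_insert htX (loopless hG t)
    have h2 : 2 ≤ dg E t X := by
      rw [← Finset.card_pair h.ab]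
      apply Finset.card_le_card
      intro w
      simp only [Finset.mem_insert, Finset.mem_singleton, Finset.mem_filter]
      have := h.va
      have := h.vb
      rintro (rfl | rfl) <;> tauto
    have hsub : insert t X ⊆ V := Finset.insert_subset ht hX.sub
    have hz' : z ∉ insert t X := by simp [hzt, hzX]
    have hc := Finset.card_insert_of_notMem htX
    have h3 := hX.two_le
    have h4 := hX.num_eq
    have h5 := num_le hG hsub (fun h => hz' (h ▸ hz)) (by omega)
    have h6 := hmax (insert t X) ⟨hsub, by omega, by omega⟩ (Finset.subset_insert t X)
      ⟨z, hz, hz', hzd⟩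
    exact htX (h6 ▸ Finset.mem_insert_self t X)
  have hk : ∀ a b c Y, Node E t a b c → c ∉ X → 4 ≤ dg E c V → Crit V E Y → a ∈ Y → b ∈ Y →
      t ∉ Y → c ∉ Y → (Y ∩ X).card ≤ 1 := by
    intro a b c Y h hcX hcd hY ha hb htY hcY
    by_contra hlt
    have htu : t ∉ Y ∪ X := by simp [htX, htY]
    have h1 := (hY.union hX hG (by omega) (fun h => htu (h ▸ ht))).1
    have h2 := hmax _ h1 Finset.subset_union_right
      ⟨c, (h.mem hG).2.2.2, by simp [hcX, hcY], hcd⟩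
    have ha' : a ∈ Y ∪ X := Finset.mem_union_left _ ha
    have hb' : b ∈ Y ∪ X := Finset.mem_union_left _ hb
    rw [h2] at ha' hb'
    exact hX2 a b c h ha' hb'
  have hXt : X ⊆ V \ {t} := by
    intro x hx
    simp only [Finset.mem_sdiff, Finset.mem_singleton]
    exact ⟨hX.sub hx, by rintro rfl; exact htX hx⟩
  have hpair : ∀ a b c Y Z, Node E t a b c → Crit V E Y → Crit V E Z → a ∈ Y → b ∈ Y → a ∈ Z →
      c ∈ Z → t ∉ Y → t ∉ Z → (Y ∩ X).card ≤ 1 → (Z ∩ X).card ≤ 1 → (Y ∩ Z).card ≤ 1 := by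
    intro a b c Y Z h hY hZ haY hbY haZ hcZ htY htZ h1 h2
    by_contra hlt
    obtain ⟨h3, h4⟩ := h.cover hG hY hZ htY htZ (by omega) (by simp [*]) (by simp [*])
      (by simp [*])
    exact hX.not_cover hG h1 h2 (h3 ▸ hXt) h4
  have core : ∀ a b c, Node E t a b c → a ∉ X → b ∉ X → 4 ≤ dg E b V →
      (c ∈ X ∨ (c ∉ X ∧ 4 ≤ dg E c V)) → False := by
    intro a b c h haX hbX hbd hc
    obtain ⟨Y, hY, haY, hbY, htY, hcY⟩ := hblock a b c h
    obtain ⟨Z, hZ, haZ, hcZ, htZ, hbZ⟩ := hblock a c b h.swap₂₃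
    have hZX := hk a c b Z h.swap₂₃ hbX hbd hZ haZ hcZ htZ hbZ
    have hYX : (Y ∩ X).card ≤ 1 := by
      rcases hc with hc | ⟨hc, hcd⟩
      · by_contra hlt
        obtain ⟨h3, h4⟩ := h.cover hG hY hX htY htX (by omega) (by simp [*]) (by simp [*])
          (by simp [*])
        obtain ⟨w, hw, hcw⟩ := dg_pos (hZ.one_le_dg hG hcZ)
        have hwX : w ∉ X := by
          intro hwX
          have : w = c := Finset.card_le_one.1 hZX w (by simp [hw, hwX]) c (by simp [hcZ, hc])
          exact loopless hG _ (this ▸ hcw)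
        have hwY : w ∈ Y := by
          have : w ∈ Y ∪ X := by
            rw [h3, Finset.mem_sdiff, Finset.mem_singleton]
            exact ⟨mem_right hG hcw, by rintro rfl; exact htZ hw⟩
          rw [Finset.mem_union] at this
          tauto
        exact h4 w hwY hwX c hc hcY (by rwa [Sym2.eq_swap])
      · exact hk a b c Y h hc hcd hY haY hbY htY hcY
    have hYZ := hpair a b c Y Z h hY hZ haY hbY haZ hcZ htY htZ hYX hZX
    have ha3 := three_le_dg hG (by omega) (h.mem hG).2.1
    rcases ha3.eq_or_lt with ha3 | ha3
    · have := h.two_le_inter hG hS hV ha3.symm hY hZ htY htZ haY hbY haZ hcZ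
      omega
    · obtain ⟨W, hW, hbW, hcW, htW, haW⟩ := hblock b c a h.swap₁₂.swap₂₃
      have hWX := hk b c a W h.swap₁₂.swap₂₃ haX ha3 hW hbW hcW htW haW
      have hWY := hpair b c a W Y h.swap₁₂.swap₂₃ hW hY hbW hcW hbY haY htW htY hWX hYX
      have hWZ := hpair c b a W Z h.swap₁₂.swap₂₃.swap₁₂ hW hZ hcW hbW hcZ haZ htW htZ hWX hZX
      exact h.not_three_blocked hG hS hV hW hZ hY htW htZ htY hbW hcW haZ hcZ haY hbY hWZ hWY
        (by rwa [Finset.inter_comm])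
  obtain ⟨a, b, c, h⟩ := exists_node htd hG
  have tri : ∀ w, s(t, w) ∈ E → dg E w V = 3 ∨ 4 ≤ dg E w V := by
    intro w hw
    have := three_le_dg hG (by omega) (mem_right hG hw)
    omega
  have ta := tri a h.va
  have tb := tri b h.vb
  have tc := tri c h.vc
  have c1 := core a b c h
  have c2 := core a c b h.swap₂₃
  have c3 := core b a c h.swap₁₂
  have c4 := core b c a h.swap₁₂.swap₂₃
  have c5 := core c a b h.swap₂₃.swap₁₂
  have c6 := core c b a h.swap₁₂.swap₂₃.swap₁₂
  have x1 := hX2 a b c h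
  have x2 := hX2 a c b h.swap₂₃
  have x3 := hX2 b c a h.swap₁₂.swap₂₃
  have o1 := fun h1 h2 h3 h4 => h.ab (hone a b h.va h.vb h1 h2 h3 h4)
  have o2 := fun h1 h2 h3 h4 => h.ac (hone a c h.va h.vc h1 h2 h3 h4)
  have o3 := fun h1 h2 h3 h4 => h.bc (hone b c h.vb h.vc h1 h2 h3 h4)
  clear hone tri core hpair hk hX2 hblock hno hmax hS hG
  by_cases ha : a ∈ X <;> by_cases hb : b ∈ X <;> by_cases hc : c ∈ X <;>
    simp only [ha, hb, hc, not_true, not_false_eq_true, false_or, true_and, false_and,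
      forall_const, false_imp_iff, imp_false, or_false] at * <;>
    rcases ta with ta | ta <;> rcases tb with tb | tb <;> rcases tc with tc | tc <;>
    simp_all

theorem num_lt_card (hG : IsRigidityCircuit V E) {N : Finset ℕ} (hN : N ⊆ V)
    (hd : ∀ v ∈ N, dg E v V = 3) (h2 : 2 ≤ (V \ N).card) (h1 : 1 ≤ N.card) :
    num E N + 1 ≤ N.card := by
  have h3 := sum_dg (loopless hG) hN
  rw [Finset.sum_congr rfl hd, Finset.sum_const, smul_eq_mul] at h3
  have h4 := Finset.card_sdiff_add_card_eq_card hN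
  have h5 := num_le hG Finset.sdiff_subset (fun h => by rw [h] at h4; omega) h2
  have h6 := num_univ hG (by omega)
  omega

theorem exists_leaf (hG : IsRigidityCircuit V E) {N : Finset ℕ} (hN : N ⊆ V)
    (hd : ∀ v ∈ N, dg E v V = 3) (h2 : 2 ≤ (V \ N).card) (hN2 : 2 ≤ N.card) (u : ℕ) :
    ∃ t ∈ N, t ≠ u ∧ dg E t N ≤ 1 := by
  by_contra! hno
  have hW : N.erase u ⊆ N := Finset.erase_subset u N
  have hWc : N.card ≤ (N.erase u).card + 1 := by
    have := Finset.pred_card_le_card_erase (s := N) (a := u)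
    omega
  have h3 := sum_dg (loopless hG) hW
  have h4 : num E (N \ N.erase u) = 0 := by
    apply num_eq_zero_of_card_le_one (loopless hG)
    have := Finset.card_sdiff_add_card_eq_card hW
    omega
  have h5 : (N.erase u).card * 2 ≤ ∑ v ∈ N.erase u, dg E v N := by
    rw [← smul_eq_mul]
    apply Finset.card_nsmul_le_sum
    intro x hx
    rw [Finset.mem_erase] at hx
    exact hno x hx.2 hx.1
  have h6 := num_lt_card hG hN hd h2 (by omega)
  have h7 := num_lt_card hG (hW.trans hN) (fun v hv => hd v (hW hv))
    (h2.trans (Finset.card_le_card (Finset.sdiff_subset_sdiff subset_rfl hW))) (by omega)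
  omega

theorem exists_adm (hG : IsRigidityCircuit V E) (hS : ∀ R S, ¬ Sep V E R S) (hV : 5 ≤ V.card)
    (hX : Crit V E X) {z : ℕ} (hz : z ∈ V) (hzX : z ∉ X) (hzd : 4 ≤ dg E z V) (u : ℕ) :
    ∃ t ∈ V, t ∉ X ∧ t ≠ u ∧ ∃ a b c, Node E t a b c ∧ Adm V E t a b c := by
  obtain ⟨Y, hYm, hYmax⟩ := Finset.exists_max_image
    (V.powerset.filter (fun Y => Crit V E Y ∧ X ⊆ Y ∧ ∃ z ∈ V, z ∉ Y ∧ 4 ≤ dg E z V))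
    Finset.card ⟨X, by simp only [Finset.mem_filter, Finset.mem_powerset]
                       exact ⟨hX.sub, hX, subset_rfl, z, hz, hzX, hzd⟩⟩
  simp only [Finset.mem_filter, Finset.mem_powerset] at hYm hYmax
  obtain ⟨hYV, hY, hXY, w, hw, hwY, hwd⟩ := hYm
  have hmax : ∀ Z, Crit V E Z → Y ⊆ Z → (∃ z ∈ V, z ∉ Z ∧ 4 ≤ dg E z V) → Z = Y :=
    fun Z hZ hYZ h => (Finset.eq_of_subset_of_card_le hYZ
      (hYmax Z ⟨hZ.sub, hZ, hXY.trans hYZ, h⟩)).symm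
  have hYc := Finset.card_sdiff_add_card_eq_card hYV
  have hsum := sum_dg (loopless hG) (Finset.sdiff_subset : V \ Y ⊆ V)
  rw [Finset.sdiff_sdiff_eq_self hYV] at hsum
  have h1 := hY.two_le
  have h2 := hY.num_eq
  have h3 := num_univ hG (by omega)
  have hwW : w ∈ V \ Y := by simp [hw, hwY]
  have hW1 := Finset.card_pos.2 ⟨w, hwW⟩
  have hW2 : 2 ≤ (V \ Y).card := by
    by_contra hlt
    have h4 := num_eq_zero_of_card_le_one (loopless hG) (X := V \ Y) (by omega)
    have h5 := Finset.single_le_sum (f := fun v => dg E v V) (fun _ _ => Nat.zero_le _) hwW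
    omega
  have h4 := num_le hG (Finset.sdiff_subset : V \ Y ⊆ V) (fun h => by rw [h] at hYc; omega) hW2
  have h5 : (V \ Y).card * 4 ≤ ∑ v ∈ V \ Y, (dg E v V + if dg E v V = 3 then 1 else 0) := by
    rw [← smul_eq_mul]
    apply Finset.card_nsmul_le_sum
    intro x hx
    have := three_le_dg hG (by omega) (Finset.mem_sdiff.1 hx).1
    split_ifs <;> omega
  rw [Finset.sum_add_distrib, ← Finset.card_filter] at h5
  obtain ⟨t, ht, htu, htd⟩ := exists_leaf hG (N := (V \ Y).filter (fun v => dg E v V = 3))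
    ((Finset.filter_subset _ _).trans Finset.sdiff_subset)
    (fun v hv => (Finset.mem_filter.1 hv).2)
    (h1.trans (Finset.card_le_card fun x hx => by
      simp only [Finset.mem_sdiff, Finset.mem_filter]
      exact ⟨hYV hx, fun h => h.1.2 hx⟩)) (by omega) u
  simp only [Finset.mem_filter, Finset.mem_sdiff] at ht
  refine ⟨t, ht.1.1, fun h => ht.1.2 (hXY h), htu, ?_⟩
  refine exists_adm_of_maximal hG hS hV hY hw hwY hwd hmax ht.1.1 ht.1.2 ht.2 ?_
  intro p q hp hq hpY hqY hpd hqd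
  refine dg_le_one htd ?_ ?_ hp hq
  · simp [mem_right hG hp, *]
  · simp [mem_right hG hq, *]

/-- The graph `(V, E)` is a circuit without separations, and deleting its node `t` and adding the
edge `pq` gives a circuit with a separation `(P, Q)` such that `P` contains `p` and `q`. -/
structure Obstruction (V : Finset ℕ) (E : Finset (Sym2 ℕ)) (t p q r : ℕ) (P Q : Finset ℕ) :
    Prop where
  circuit : IsRigidityCircuit V E
  not_sep : ∀ R S, ¬ Sep V E R S
  five_le : 5 ≤ V.card
  node : Node E t p q r
  adm : Adm V E t p q r
  sep : Sep (V \ {t}) (reduce E t p q) P Q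
  left_mem : p ∈ P
  right_mem : q ∈ P

namespace Obstruction

variable {p q r : ℕ} {P Q : Finset ℕ}

theorem card_sdiff (h : Obstruction V E t p q r P Q) : (V \ {t}).card + 1 = V.card := by
  have := Finset.card_sdiff_add_card_eq_card
    (Finset.singleton_subset_iff.2 (h.node.mem h.circuit).1)
  simpa using this

theorem spec (h : Obstruction V E t p q r P Q) :
    Crit (V \ {t}) (reduce E t p q) P ∧ Crit (V \ {t}) (reduce E t p q) Q ∧ 3 ≤ P.card ∧
      3 ≤ Q.card ∧ (P ∩ Q).card = 2 ∧
      ∀ c ∈ P ∩ Q, ∀ d ∈ P ∩ Q, s(c, d) ∉ reduce E t p q :=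
  h.sep.spec (h.adm.isRigidityCircuit h.node h.circuit) (by
    have := h.card_sdiff
    have := h.five_le
    omega)

theorem card_add_card (h : Obstruction V E t p q r P Q) : P.card + Q.card = V.card + 1 := by
  have h1 := Finset.card_union_add_card_inter P Q
  rw [h.sep.union, h.spec.2.2.2.2.1] at h1
  have := h.card_sdiff
  omega

theorem notMem_left (h : Obstruction V E t p q r P Q) : t ∉ P := fun ht => by
  have := h.spec.1.sub ht
  simp at this

theorem notMem_right (h : Obstruction V E t p q r P Q) : t ∉ Q := fun ht => by
  have := h.spec.2.1.sub ht
  simp at this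

theorem subset_left (h : Obstruction V E t p q r P Q) : P ⊆ V :=
  h.spec.1.sub.trans Finset.sdiff_subset

theorem subset_right (h : Obstruction V E t p q r P Q) : Q ⊆ V :=
  h.spec.2.1.sub.trans Finset.sdiff_subset

theorem mem_or (h : Obstruction V E t p q r P Q) (hx : x ∈ V) : x = t ∨ x ∈ P ∨ x ∈ Q := by
  by_cases hxt : x = t
  · exact Or.inl hxt
  · have : x ∈ V \ {t} := by simp [hx, hxt]
    rw [← h.sep.union, Finset.mem_union] at this
    exact Or.inr this

theorem not_both (h : Obstruction V E t p q r P Q) : ¬ (p ∈ Q ∧ q ∈ Q) := by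
  rintro ⟨hp, hq⟩
  exact h.spec.2.2.2.2.2 p (Finset.mem_inter.2 ⟨h.left_mem, hp⟩) q
    (Finset.mem_inter.2 ⟨h.right_mem, hq⟩) (mem_reduce.2 (Or.inr rfl))

theorem edge (h : Obstruction V E t p q r P Q) (hxy : s(x, y) ∈ E) (hx : x ≠ t) (hy : y ≠ t) :
    (x ∈ P ∧ y ∈ P) ∨ (x ∈ Q ∧ y ∈ Q) :=
  h.sep.edge x y (mem_reduce.2 (Or.inl ⟨hxy, hx.symm, hy.symm⟩))

theorem third_notMem (h : Obstruction V E t p q r P Q) : r ∉ P := by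
  intro hr
  have htV := (h.node.mem h.circuit).1
  refine h.not_sep (insert t P) Q ⟨?_, ?_, ⟨t, by simp, h.notMem_right⟩, ?_, ?_⟩
  · rw [Finset.insert_union, h.sep.union, ← Finset.erase_eq, Finset.insert_erase htV]
  · rw [Finset.insert_inter_of_notMem h.notMem_right]
    exact h.sep.inter
  · obtain ⟨z, hz, hz'⟩ := h.sep.right
    refine ⟨z, hz, ?_⟩
    rw [Finset.mem_insert, not_or]
    exact ⟨by rintro rfl; exact h.notMem_right hz, hz'⟩
  · have key : ∀ y, s(t, y) ∈ E → y ∈ insert t P := by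
      intro y hy
      rcases h.node.eq y hy with rfl | rfl | rfl
      · exact Finset.mem_insert_of_mem h.left_mem
      · exact Finset.mem_insert_of_mem h.right_mem
      · exact Finset.mem_insert_of_mem hr
    intro x y hxy
    by_cases hx : x = t
    · subst hx
      exact Or.inl ⟨Finset.mem_insert_self _ _, key y hxy⟩
    · by_cases hy : y = t
      · subst hy
        exact Or.inl ⟨key x (by rwa [Sym2.eq_swap]), Finset.mem_insert_self _ _⟩
      · rcases h.edge hxy hx hy with h1 | h1
        · exact Or.inl ⟨Finset.mem_insert_of_mem h1.1, Finset.mem_insert_of_mem h1.2⟩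
        · exact Or.inr h1

theorem third_mem (h : Obstruction V E t p q r P Q) : r ∈ Q := by
  have h1 := h.mem_or (h.node.mem h.circuit).2.2.2
  have h2 := (h.node.ne h.circuit).2.2
  have h3 := h.third_notMem
  grind

theorem crit_right (h : Obstruction V E t p q r P Q) : Crit V E Q := by
  have h1 := h.spec.2.1
  have h2 := h1.num_eq
  rw [num_eq_of_edge (reduce_iff h.notMem_right) h.not_both] at h2
  exact ⟨h.subset_right, h1.two_le, h2⟩

theorem num_left (h : Obstruction V E t p q r P Q) : num E P + 4 = 2 * P.card := by
  have h2 := h.spec.1.num_eq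
  rw [num_eq_of_edge_mem (reduce_iff h.notMem_left) (h.adm.notMem h.node h.circuit) h.left_mem
    h.right_mem] at h2
  omega

theorem exists_nbr (h : Obstruction V E t p q r P Q) {w : ℕ} (hw : w ∈ P ∩ Q) (x : ℕ) :
    ∃ w', w' ≠ x ∧ w' ∉ Q ∧ s(w, w') ∈ E := by
  have hH := h.adm.isRigidityCircuit h.node h.circuit
  have hw' := Finset.mem_inter.1 hw
  have hd := h.spec.1.two_le_dg hH h.spec.2.2.1 hw'.1
  have hQ : ∀ z, s(w, z) ∈ reduce E t p q → z ∈ P → z ∉ Q := fun z hz hzP hzQ =>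
    h.spec.2.2.2.2.2 w hw z (Finset.mem_inter.2 ⟨hzP, hzQ⟩) hz
  obtain ⟨w₁, hw₁, hne, he⟩ := dg_one_lt hd x
  rcases mem_reduce.1 he with he' | he'
  · exact ⟨w₁, hne, hQ _ he hw₁, he'.1⟩
  · by_cases htx : t = x
    · subst htx
      obtain ⟨w₂, hw₂, hne₂, he₂⟩ := dg_one_lt hd w₁
      rcases mem_reduce.1 he₂ with he₃ | he₃
      · exact ⟨w₂, fun h => he₃.2.2 h.symm, hQ _ he₂ hw₂, he₃.1⟩
      · exact absurd (Sym2.congr_right.1 (he₃.trans he'.symm)) hne₂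
    · refine ⟨t, htx, h.notMem_right, ?_⟩
      rw [Sym2.eq_swap]
      rw [Sym2.eq_iff] at he'
      rcases he' with ⟨rfl, -⟩ | ⟨rfl, -⟩
      · exact h.node.va
      · exact h.node.vb

theorem not_left (h : Obstruction V E t p q r P Q) {t' p' q' r' : ℕ}
    (h' : Obstruction V E t' p' q' r' R S) (htP : t' ∈ P) (htQ : t' ∉ Q)
    (hR : P.card ≤ R.card) (hS : P.card ≤ S.card) : False := by
  have hH := h'.adm.isRigidityCircuit h'.node h'.circuit
  have htt : t ≠ t' := by rintro rfl; exact h.notMem_left htP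
  have hQt : Q ⊆ V \ {t'} := by
    intro x hx
    simp only [Finset.mem_sdiff, Finset.mem_singleton]
    exact ⟨h.subset_right hx, by rintro rfl; exact htQ hx⟩
  have hQ := h.crit_right
  have hpq : ¬ (p' ∈ Q ∧ q' ∈ Q) := by
    rintro ⟨hp, hq⟩
    have h1 := num_eq_of_edge_mem (reduce_iff htQ) (h'.adm.notMem h'.node h'.circuit) hp hq
    have h2 := num_le hH hQt (fun heq => h.notMem_right (by
      rw [heq]
      simp [htt, (h.node.mem h.circuit).1])) hQ.two_le
    have h3 := hQ.num_eq
    omega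
  have hQ' : Crit (V \ {t'}) (reduce E t' p' q') Q := by
    refine ⟨hQt, hQ.two_le, ?_⟩
    rw [num_eq_of_edge (reduce_iff htQ) hpq]
    exact hQ.num_eq
  have key : ¬ S ⊆ Q := by
    intro hSQ
    have hrQ := hSQ h'.third_mem
    have hrt := (h'.node.ne h'.circuit).2.2
    have hrP : r' ∈ P := by
      rcases h.edge h'.node.vc htt.symm (by rintro rfl; exact h.notMem_right hrQ) with h1 | h1
      · exact h1.2
      · exact absurd h1.1 htQ
    obtain ⟨w, hwt, hwQ, hw⟩ := h.exists_nbr (Finset.mem_inter.2 ⟨hrP, hrQ⟩) t'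
    rcases h'.edge hw hrt.symm hwt with h1 | h1
    · exact h'.third_notMem h1.1
    · exact hwQ (hSQ h1.2)
  have c1 := h.card_add_card
  have c2 := h'.card_add_card
  have hc := h'.card_sdiff
  have h5 := h'.five_le
  rcases h'.sep.subset_or hH (by omega) hQ' with h1 | h1 | h1 | h1
  · have := Finset.eq_of_subset_of_card_le h1 (by omega)
    rw [this] at hpq
    exact hpq ⟨h'.left_mem, h'.right_mem⟩
  · have := Finset.eq_of_subset_of_card_le h1 (by omega)
    exact key this.ge
  · exact hpq ⟨h1 h'.left_mem, h1 h'.right_mem⟩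
  · exact key h1

theorem nbr_mem (h : Obstruction V E t p q r P Q) {w : ℕ} (hxQ : x ∈ Q) (hxP : x ∉ P)
    (hxr : x ≠ r) (hxw : s(x, w) ∈ E) : w ∈ Q := by
  have hwt : w ≠ t := by
    rintro rfl
    rcases h.node.eq x (by rwa [Sym2.eq_swap]) with rfl | rfl | rfl
    · exact hxP h.left_mem
    · exact hxP h.right_mem
    · exact hxr rfl
  rcases h.edge hxw (by rintro rfl; exact h.notMem_right hxQ) hwt with h1 | h1
  · exact absurd h1.1 hxP
  · exact h1.2

theorem not_right (h : Obstruction V E t p q r P Q) {t' p' q' r' : ℕ}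
    (h' : Obstruction V E t' p' q' r' R S) (htQ : t' ∈ Q) (htP : t' ∉ P) (htr : t' ≠ r)
    (hR : Q.card ≤ R.card) (hS : Q.card ≤ S.card) : False := by
  have hH := h'.adm.isRigidityCircuit h'.node h'.circuit
  have hnbr : ∀ w, s(t', w) ∈ E → w ∈ Q.erase t' := by
    intro w hw
    refine Finset.mem_erase.2 ⟨?_, h.nbr_mem htQ htP htr hw⟩
    rintro rfl
    exact loopless h.circuit _ hw
  have hp := hnbr _ h'.node.va
  have hq := hnbr _ h'.node.vb
  have hr := hnbr _ h'.node.vc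
  have htX : t' ∉ Q.erase t' := Finset.notMem_erase _ _
  have h1 := num_insert htX (loopless h.circuit t')
  rw [h'.node.dg_eq hp hq hr, Finset.insert_erase htQ] at h1
  have h2 := num_eq_of_edge_mem (reduce_iff htX) (h'.adm.notMem h'.node h'.circuit) hp hq
  have h3 := Finset.card_erase_of_mem htQ
  have h4 := h.spec.2.2.2.1
  have h5 := h.crit_right.num_eq
  have hX : Crit (V \ {t'}) (reduce E t' p' q') (Q.erase t') := by
    refine ⟨?_, by omega, by omega⟩
    intro x hx
    rw [Finset.mem_erase] at hx
    simp [h.subset_right hx.2, hx.1]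
  have hc := h'.card_sdiff
  have h6 := h'.five_le
  rcases h'.sep.subset_or hH (by omega) hX with h1 | h1 | h1 | h1
  · exact h'.third_notMem (h1 hr)
  · exact h'.not_both ⟨h1 hp, h1 hq⟩
  · have := Finset.card_le_card h1
    omega
  · have := Finset.card_le_card h1
    omega

end Obstruction

theorem Node.exists_of_dg_le_one {p q r : ℕ} {N T : Finset ℕ} (h : Node E t p q r)
    (hd : dg E t N ≤ 1) (hT : T.card ≤ 2) (hN : ∀ w, s(t, w) ∈ E → w ∉ N → w ∈ T) :
    ∃ x a b, Node E t x a b ∧ x ∈ N ∧ a ∈ T ∧ b ∈ T := by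
  have h1 := hN p h.va
  have h2 := hN q h.vb
  have h3 := hN r h.vc
  have u1 : ¬ (p ∈ N ∧ q ∈ N) := fun hc => h.ab (dg_le_one hd hc.1 hc.2 h.va h.vb)
  have u2 : ¬ (p ∈ N ∧ r ∈ N) := fun hc => h.ac (dg_le_one hd hc.1 hc.2 h.va h.vc)
  have u3 : ¬ (q ∈ N ∧ r ∈ N) := fun hc => h.bc (dg_le_one hd hc.1 hc.2 h.vb h.vc)
  have h4 : ¬ (p ∈ T ∧ q ∈ T ∧ r ∈ T) := by
    rintro ⟨hp, hq, hr⟩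
    have := Finset.card_le_card (show ({p, q, r} : Finset ℕ) ⊆ T by
      intro w
      simp only [Finset.mem_insert, Finset.mem_singleton]
      rintro (rfl | rfl | rfl) <;> assumption)
    rw [Finset.card_eq_three.2 ⟨p, q, r, h.ab, h.ac, h.bc, rfl⟩] at this
    omega
  by_cases hp : p ∈ N
  · exact ⟨p, q, r, h, hp, by tauto, by tauto⟩
  · by_cases hq : q ∈ N
    · exact ⟨q, p, r, h.swap₁₂, hq, by tauto, by tauto⟩
    · exact ⟨r, p, q, h.swap₂₃.swap₁₂, by tauto, by tauto, by tauto⟩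

namespace Obstruction

variable {p q r : ℕ} {P Q : Finset ℕ}

theorem exists_adm_left (h : Obstruction V E t p q r P Q) :
    ∃ t' ∈ P, t' ∉ Q ∧ ∃ a b c, Node E t' a b c ∧ Adm V E t' a b c := by
  have hG := h.circuit
  have htV := (h.node.mem hG).1
  have hV := h.five_le
  obtain ⟨-, -, hP3, hQ3, hPQ, -⟩ := h.spec
  have hmem : ∀ x ∈ V, x ∉ Q → x ≠ t → x ∈ P := fun x hx hxQ hxt => by
    rcases h.mem_or hx with h1 | h1 | h1
    · exact absurd h1 hxt
    · exact h1
    · exact absurd h1 hxQ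
  by_cases hz : ∃ z ∈ P, z ∉ Q ∧ 4 ≤ dg E z V
  · obtain ⟨z, hzP, hzQ, hzd⟩ := hz
    obtain ⟨t', ht', htQ, htt, h1⟩ := exists_adm hG h.not_sep hV h.crit_right
      (h.subset_left hzP) hzQ hzd t
    exact ⟨t', hmem t' ht' htQ htt, htQ, h1⟩
  · push Not at hz
    have hNV : insert t (P \ Q) ⊆ V :=
      Finset.insert_subset htV (Finset.sdiff_subset.trans h.subset_left)
    have hd : ∀ v ∈ insert t (P \ Q), dg E v V = 3 := by
      intro v hv
      rcases Finset.mem_insert.1 hv with rfl | hv'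
      · exact h.node.dg_eq (h.node.mem hG).2.1 (h.node.mem hG).2.2.1 (h.node.mem hG).2.2.2
      · have h1 := three_le_dg hG (by omega) (hNV hv)
        rw [Finset.mem_sdiff] at hv'
        have := hz v hv'.1 hv'.2
        omega
    have hQN : Q ⊆ V \ insert t (P \ Q) := by
      intro x hx
      simp only [Finset.mem_sdiff, Finset.mem_insert]
      refine ⟨h.subset_right hx, ?_⟩
      rintro (rfl | h1)
      · exact h.notMem_right hx
      · exact h1.2 hx
    have hN2 : 2 ≤ (insert t (P \ Q)).card := by
      have h1 := Finset.card_sdiff_add_card_inter P Q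
      rw [Finset.card_insert_of_notMem (fun h1 => h.notMem_left (Finset.mem_sdiff.1 h1).1)]
      omega
    obtain ⟨t', ht', htt, htd⟩ := exists_leaf hG hNV hd
      (by have := Finset.card_le_card hQN; omega) hN2 t
    have htPQ := (Finset.mem_insert.1 ht').resolve_left htt
    rw [Finset.mem_sdiff] at htPQ
    obtain ⟨htP, htQ⟩ := htPQ
    obtain ⟨_, _, _, hnode⟩ := exists_node (hd t' ht') hG
    obtain ⟨x, a, b, hN, hx, ha, hb⟩ := hnode.exists_of_dg_le_one htd hPQ.le (by
      intro w hw hwN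
      rw [Finset.mem_insert, not_or, Finset.mem_sdiff, not_and, not_not] at hwN
      rcases h.edge hw htt hwN.1 with h1 | h1
      · exact Finset.mem_inter.2 ⟨h1.2, hwN.2 h1.2⟩
      · exact absurd h1.1 htQ)
    refine ⟨t', htP, htQ, ?_⟩
    by_contra! hno
    have key : ∀ a b Y, Node E t' x a b → b ∈ P ∩ Q → Crit V E Y → x ∈ Y → a ∈ Y → t' ∉ Y →
        b ∉ Y → (Y ∩ Q).card ≤ 1 := by
      intro a b Y hN hb hY hxY haY htY hbY
      by_contra hlt
      have hbQ := (Finset.mem_inter.1 hb).2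
      obtain ⟨h1, h2⟩ := hN.cover hG hY h.crit_right htY htQ (by omega) (by simp [*])
        (by simp [*]) (by simp [*])
      obtain ⟨w, hwt, hwQ, hw⟩ := h.exists_nbr hb t'
      have hwY : w ∈ Y ∪ Q := by
        rw [h1]
        simp [mem_right hG hw, hwt]
      refine h2 w ?_ hwQ b hbQ hbY (by rwa [Sym2.eq_swap])
      rw [Finset.mem_union] at hwY
      tauto
    have hna := hno x a b hN
    have hnb := hno x b a hN.swap₂₃
    unfold Adm at hna hnb
    push Not at hna hnb
    obtain ⟨Y, hY, hxY, haY, htY, hbY⟩ := hna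
    obtain ⟨Z, hZ, hxZ, hbZ, htZ, haZ⟩ := hnb
    have k1 := key a b Y hN hb hY hxY haY htY hbY
    have k2 := key b a Z hN.swap₂₃ ha hZ hxZ hbZ htZ haZ
    have k3 := hN.two_le_inter hG h.not_sep hV (hd x hx) hY hZ htY htZ hxY haY hxZ hbZ
    have k4 := (hN.cover hG hY hZ htY htZ k3 (by simp [*]) (by simp [*]) (by simp [*])).1
    have k5 : Q ⊆ (Y ∩ Q) ∪ (Z ∩ Q) := by
      intro z hzQ
      have : z ∈ Y ∪ Z := by
        rw [k4, Finset.mem_sdiff, Finset.mem_singleton]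
        exact ⟨h.subset_right hzQ, by rintro rfl; exact htQ hzQ⟩
      rw [← Finset.union_inter_distrib_right]
      exact Finset.mem_inter.2 ⟨this, hzQ⟩
    have k6 := Finset.card_le_card k5
    have k7 := Finset.card_union_le (Y ∩ Q) (Z ∩ Q)
    omega

theorem num_add_four_le (h : Obstruction V E t p q r P Q) (hX : X ⊆ Q) (hPX : P ∩ Q ⊆ X)
    (hne : X ≠ Q) : num E X + 4 ≤ 2 * X.card := by
  have hH := h.adm.isRigidityCircuit h.node h.circuit
  obtain ⟨hP, hQ, hP3, hQ3, hPQ, h0⟩ := h.spec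
  have hXP : X ∩ P = P ∩ Q := by
    ext x
    have := @hX x
    have := @hPX x
    simp only [Finset.mem_inter] at *
    tauto
  have h1 := num_add_num_le (E := reduce E t p q) (X := X) (Y := P)
  have h2 := Finset.card_union_add_card_inter X P
  rw [hXP] at h1 h2
  have h3 : num (reduce E t p q) (P ∩ Q) = 0 := by
    by_contra hne
    obtain ⟨e, he⟩ := Finset.card_pos.1 (Nat.pos_of_ne_zero hne)
    induction e with | _ x y
    rw [mem_spans] at he
    exact h0 x he.2.1 y he.2.2 he.1
  obtain ⟨w, hw, hwX⟩ := Finset.exists_of_ssubset (hX.ssubset_of_ne hne)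
  have hwP : w ∉ P := fun h1 => hwX (hPX (Finset.mem_inter.2 ⟨h1, hw⟩))
  have hsub : X ∪ P ⊆ V \ {t} := Finset.union_subset (hX.trans hQ.sub) hP.sub
  have h4 := num_le hH hsub (fun heq => by
    have : w ∈ X ∪ P := heq ▸ hQ.sub hw
    rw [Finset.mem_union] at this
    tauto) (by
      have := Finset.card_le_card (Finset.subset_union_right : P ⊆ X ∪ P)
      omega)
  have h5 := num_eq_of_edge (E := E) (reduce_iff (p := p) (q := q) (t := t) (X := X)
    (fun h1 => h.notMem_right (hX h1))) (fun h1 => h.not_both ⟨hX h1.1, hX h1.2⟩)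
  have h6 := hP.num_eq
  omega

theorem isRigidityCircuit_right (h : Obstruction V E t p q r P Q) (hab : P ∩ Q = {a, b}) :
    IsRigidityCircuit Q (spans E Q ∪ {s(a, b)}) := by
  have hPQ := h.spec.2.2.2.2.1
  have hne : a ≠ b := by
    rintro rfl
    rw [hab] at hPQ
    simp at hPQ
  have ha : a ∈ P ∩ Q := by simp [hab]
  have hb : b ∈ P ∩ Q := by simp [hab]
  have haQ := (Finset.mem_inter.1 ha).2
  have hbQ := (Finset.mem_inter.1 hb).2
  have habE : s(a, b) ∉ E := fun he => h.spec.2.2.2.2.2 a ha b hb (mem_reduce.2 (Or.inl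
    ⟨he, by rintro rfl; exact h.notMem_right haQ, by rintro rfl; exact h.notMem_right hbQ⟩))
  have hiff : ∀ X ⊆ Q, ∀ x ∈ X, ∀ y ∈ X,
      s(x, y) ∈ spans E Q ∪ {s(a, b)} ↔ s(x, y) ∈ E ∨ s(x, y) = s(a, b) := by
    intro X hX x hx y hy
    rw [Finset.mem_union, mem_spans, Finset.mem_singleton]
    have := hX hx
    have := hX hy
    tauto
  have hQ := h.crit_right
  apply isRigidityCircuit_of
  · intro v hv
    rw [Finset.mem_union, mem_spans, Finset.mem_singleton, Sym2.eq_iff] at hv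
    rcases hv with hv | ⟨rfl, rfl⟩ | ⟨rfl, rfl⟩
    · exact loopless h.circuit _ hv.1
    · exact hne rfl
    · exact hne rfl
  · intro x y hxy
    rw [Finset.mem_union, mem_spans, Finset.mem_singleton, Sym2.eq_iff] at hxy
    rcases hxy with hv | ⟨rfl, rfl⟩ | ⟨rfl, rfl⟩
    · exact hv.2.1
    · exact haQ
    · exact hbQ
  · rw [num_eq_of_edge_mem (hiff Q subset_rfl) habE haQ hbQ]
    have := hQ.num_eq
    omega
  · intro X hX hXne h2
    by_cases hm : a ∈ X ∧ b ∈ X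
    · rw [num_eq_of_edge_mem (hiff X hX) habE hm.1 hm.2]
      have := h.num_add_four_le hX (by
        rw [hab]
        exact Finset.insert_subset hm.1 (Finset.singleton_subset_iff.2 hm.2)) hXne
      omega
    · rw [num_eq_of_edge (hiff X hX) hm]
      exact num_le h.circuit (hX.trans hQ.sub) (fun heq => h.notMem_right
        (hX (heq ▸ (h.node.mem h.circuit).1))) h2

theorem not_sep_right (h : Obstruction V E t p q r P Q) (hab : P ∩ Q = {a, b})
    (hmin : ∀ R S, Sep (V \ {t}) (reduce E t p q) R S → Q.card ≤ S.card) (R S : Finset ℕ) :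
    ¬ Sep Q (spans E Q ∪ {s(a, b)}) R S := by
  have htV := (h.node.mem h.circuit).1
  have core : ∀ R S, Sep Q (spans E Q ∪ {s(a, b)}) R S → a ∈ R → b ∈ R → False := by
    intro R S hRS ha hb
    have hRQ : R ⊆ Q := hRS.union ▸ Finset.subset_union_left
    have hSQ : S ⊆ Q := hRS.union ▸ Finset.subset_union_right
    have hQRS : ∀ x ∈ Q, x ∈ R ∨ x ∈ S := fun x hx => by
      rwa [← hRS.union, Finset.mem_union] at hx
    have hPR : ∀ x ∈ P, x ∈ Q → x ∈ R := by
      intro x hxP hxQ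
      have : x ∈ P ∩ Q := Finset.mem_inter.2 ⟨hxP, hxQ⟩
      rw [hab, Finset.mem_insert, Finset.mem_singleton] at this
      rcases this with rfl | rfl <;> assumption
    have htS : t ∉ S := fun h1 => h.notMem_right (hSQ h1)
    have hedge : ∀ x y, s(x, y) ∈ reduce E t p q →
        (x ∈ R ∪ P ∧ y ∈ R ∪ P) ∨ (x ∈ S ∧ y ∈ S) := by
      intro x y hxy
      simp only [Finset.mem_union]
      rcases h.sep.edge x y hxy with h1 | h1
      · exact Or.inl ⟨Or.inr h1.1, Or.inr h1.2⟩
      · rcases mem_reduce.1 hxy with h2 | h2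
        · rcases hRS.edge x y (Finset.mem_union_left _ (mem_spans.2 ⟨h2.1, h1⟩)) with h3 | h3
          · exact Or.inl ⟨Or.inl h3.1, Or.inl h3.2⟩
          · exact Or.inr h3
        · rw [Sym2.eq_iff] at h2
          rcases h2 with ⟨rfl, rfl⟩ | ⟨rfl, rfl⟩
          · exact absurd h1 h.not_both
          · exact absurd h1.symm h.not_both
    have hunion : (R ∪ P) ∪ S = V \ {t} := by
      rw [Finset.union_right_comm, hRS.union, Finset.union_comm, h.sep.union]
    have hinter : ((R ∪ P) ∩ S).card ≤ 2 := by
      refine (Finset.card_le_card ?_).trans hRS.inter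
      intro x hx
      rw [Finset.mem_inter, Finset.mem_union] at hx
      rw [Finset.mem_inter]
      refine ⟨?_, hx.2⟩
      rcases hx.1 with h1 | h1
      · exact h1
      · exact hPR x h1 (hSQ hx.2)
    obtain ⟨z, hzS, hzR⟩ := hRS.right
    have hz : z ∉ R ∪ P := by
      rw [Finset.mem_union, not_or]
      exact ⟨hzR, fun h1 => hzR (hPR z h1 (hSQ hzS))⟩
    rcases hQRS r h.third_mem with hr | hr
    · refine h.not_sep (insert t (R ∪ P)) S ⟨?_, ?_, ⟨t, by simp, htS⟩, ⟨z, hzS, ?_⟩, ?_⟩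
      · rw [Finset.insert_union, hunion, ← Finset.erase_eq, Finset.insert_erase htV]
      · rwa [Finset.insert_inter_of_notMem htS]
      · rw [Finset.mem_insert, not_or]
        exact ⟨by rintro rfl; exact htS hzS, hz⟩
      · have key : ∀ y, s(t, y) ∈ E → y ∈ insert t (R ∪ P) := by
          intro y hy
          rw [Finset.mem_insert, Finset.mem_union]
          rcases h.node.eq y hy with rfl | rfl | rfl
          · exact Or.inr (Or.inr h.left_mem)
          · exact Or.inr (Or.inr h.right_mem)
          · exact Or.inr (Or.inl hr)
        intro x y hxy
        by_cases hx : x = t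
        · subst hx
          exact Or.inl ⟨Finset.mem_insert_self _ _, key y hxy⟩
        · by_cases hy : y = t
          · subst hy
            exact Or.inl ⟨key x (by rwa [Sym2.eq_swap]), Finset.mem_insert_self _ _⟩
          · rcases hedge x y (mem_reduce.2 (Or.inl ⟨hxy, Ne.symm hx, Ne.symm hy⟩)) with h1 | h1
            · exact Or.inl ⟨Finset.mem_insert_of_mem h1.1, Finset.mem_insert_of_mem h1.2⟩
            · exact Or.inr h1
    · obtain ⟨w, hwR, hwS⟩ := hRS.left
      have h1 := hmin (R ∪ P) S ⟨hunion, hinter, ⟨w, Finset.mem_union_left _ hwR, hwS⟩,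
        ⟨z, hzS, hz⟩, hedge⟩
      have h2 := Finset.card_lt_card (hSQ.ssubset_of_ne (fun heq => hwS (heq ▸ hRQ hwR)))
      omega
  intro hRS
  rcases hRS.edge a b (by simp) with h1 | h1
  · exact core R S hRS h1.1 h1.2
  · exact core S R hRS.symm h1.1 h1.2

theorem adm_of_adm_right (h : Obstruction V E t p q r P Q) (hab : P ∩ Q = {a, b}) {t' x y z : ℕ}
    (hN : Node E t' x y z) (htQ : t' ∈ Q) (hx : x ∈ Q) (hy : y ∈ Q)
    (hadm : Adm Q (spans E Q ∪ {s(a, b)}) t' x y z) : Adm V E t' x y z := by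
  intro Y hY hxY hyY htY
  by_contra hzY
  have hG := h.circuit
  have hF := h.isRigidityCircuit_right hab
  have ha : a ∈ P ∩ Q := by simp [hab]
  have hb : b ∈ P ∩ Q := by simp [hab]
  have hPQ := h.spec.2.2.2.2.1
  have hne : a ≠ b := by
    rintro rfl
    rw [hab] at hPQ
    simp at hPQ
  have hQ := h.crit_right
  have hZ2 : 2 ≤ (Q ∩ Y).card := by
    rw [← Finset.card_pair hN.ab]
    apply Finset.card_le_card
    refine Finset.insert_subset ?_ (Finset.singleton_subset_iff.2 ?_)
    · exact Finset.mem_inter.2 ⟨hx, hxY⟩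
    · exact Finset.mem_inter.2 ⟨hy, hyY⟩
  have hZQ : Q ∩ Y ⊆ Q := Finset.inter_subset_left
  have hle := num_le hF hZQ (fun heq => htY (Finset.inter_eq_left.1 heq htQ)) hZ2
  have hmono : num E (Q ∩ Y) ≤ num (spans E Q ∪ {s(a, b)}) (Q ∩ Y) := by
    apply Finset.card_le_card
    intro e
    induction e with | _ u v
    rw [mem_spans, mem_spans, Finset.mem_union, mem_spans]
    rintro ⟨h1, h2, h3⟩
    exact ⟨Or.inl ⟨h1, hZQ h2, hZQ h3⟩, h2, h3⟩
  have hcon : num (spans E Q ∪ {s(a, b)}) (Q ∩ Y) + 4 ≤ 2 * (Q ∩ Y).card := by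
    by_contra hlt
    have := hadm (Q ∩ Y) ⟨hZQ, hZ2, by omega⟩ (Finset.mem_inter.2 ⟨hx, hxY⟩)
      (Finset.mem_inter.2 ⟨hy, hyY⟩) (fun h1 => htY (Finset.mem_inter.1 h1).2)
    exact hzY (Finset.mem_inter.1 this).2
  have hc := Finset.card_union_add_card_inter Q Y
  have hn := num_add_num_le (E := E) (X := Q) (Y := Y)
  have e1 := hQ.num_eq
  have e2 := hY.num_eq
  have hsub := Finset.union_subset hQ.sub hY.sub
  have hU2 := Finset.card_le_card (Finset.subset_union_left : Q ⊆ Q ∪ Y)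
  have hQ2 := hQ.two_le
  by_cases hV : Q ∪ Y = V
  · have hnV := num_univ hG (by have := h.five_le; omega)
    rw [← hV] at hnV
    have hcross : ∀ u ∈ Q, u ∉ Y → ∀ v ∈ Y, v ∉ Q → s(u, v) ∉ E := by
      intro u hu huY v hv hvQ huv
      have := num_add_num_lt hu huY hv hvQ huv
      omega
    have hmem : ∀ w ∈ P ∩ Q, w ∈ Q ∩ Y := by
      intro w hw
      have hwQ := (Finset.mem_inter.1 hw).2
      refine Finset.mem_inter.2 ⟨hwQ, ?_⟩
      by_contra hwY
      obtain ⟨v, -, hvQ, hv⟩ := h.exists_nbr hw w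
      have : v ∈ Q ∪ Y := hV ▸ mem_right hG hv
      exact hcross w hwQ hwY v (by rw [Finset.mem_union] at this; tauto) hvQ hv
    have habE : s(a, b) ∉ E := fun he => h.spec.2.2.2.2.2 a ha b hb (mem_reduce.2 (Or.inl
      ⟨he, by rintro rfl; exact h.notMem_right (Finset.mem_inter.1 ha).2,
        by rintro rfl; exact h.notMem_right (Finset.mem_inter.1 hb).2⟩))
    have := num_eq_of_edge_mem (X := Q ∩ Y) (F := spans E Q ∪ {s(a, b)}) (E := E) (by
      intro u hu v hv
      rw [Finset.mem_union, mem_spans, Finset.mem_singleton]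
      have := hZQ hu
      have := hZQ hv
      tauto) habE (hmem a ha) (hmem b hb)
    omega
  · have := num_le hG hsub hV (by omega)
    omega

theorem dg_third (h : Obstruction V E t p q r P Q) : dg E t (insert t P) ≤ 2 := by
  have h1 : (insert t P).filter (fun w => s(t, w) ∈ E) ⊆ {p, q} := by
    intro w
    simp only [Finset.mem_filter, Finset.mem_insert, Finset.mem_singleton]
    rintro ⟨rfl | hw, he⟩
    · exact absurd he (loopless h.circuit _)
    · rcases h.node.eq w he with rfl | rfl | rfl
      · exact Or.inl rfl
      · exact Or.inr rfl
      · exact absurd hw h.third_notMem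
  exact (Finset.card_le_card h1).trans Finset.card_le_two

theorem crit_inter_left (h : Obstruction V E t p q r P Q) (hab : P ∩ Q = {a, b})
    (hY : Crit V E Y) {w : ℕ} (haY : a ∈ Y) (hbY : b ∉ Y) (hxY : x ∈ Y) (hxQ : x ∈ Q) (hxa : x ≠ a)
    (hwY : w ∈ Y) (hwQ : w ∉ Q) : t ∈ Y ∧ Crit V E (Y ∩ insert t P) := by
  have hG := h.circuit
  have ha : a ∈ P ∩ Q := by simp [hab]
  have hb : b ∈ P ∩ Q := by simp [hab]
  rw [Finset.mem_inter] at ha hb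
  have hmem : ∀ z ∈ Y, z ∈ insert t P ∨ z ∈ Q := by
    intro z hz
    rw [Finset.mem_insert]
    have := h.mem_or (hY.sub hz)
    tauto
  have hedge : ∀ u v, s(u, v) ∈ E → s(u, v) ≠ s(t, r) →
      (u ∈ insert t P ∧ v ∈ insert t P) ∨ (u ∈ Q ∧ v ∈ Q) := by
    have key : ∀ v, s(t, v) ∈ E → s(t, v) ≠ s(t, r) → v ∈ insert t P := by
      intro v hv hne
      rcases h.node.eq v hv with rfl | rfl | rfl
      · exact Finset.mem_insert_of_mem h.left_mem
      · exact Finset.mem_insert_of_mem h.right_mem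
      · exact absurd rfl hne
    intro u v huv hne
    by_cases hu : u = t
    · subst hu
      exact Or.inl ⟨Finset.mem_insert_self _ _, key v huv hne⟩
    · by_cases hv : v = t
      · subst hv
        rw [Sym2.eq_swap] at huv hne
        exact Or.inl ⟨key u huv hne, Finset.mem_insert_self _ _⟩
      · rcases h.edge huv hu hv with h1 | h1
        · exact Or.inl ⟨Finset.mem_insert_of_mem h1.1, Finset.mem_insert_of_mem h1.2⟩
        · exact Or.inr h1
  have hU : (Y ∩ insert t P) ∪ (Y ∩ Q) = Y := by
    rw [← Finset.inter_union_distrib_left, Finset.inter_eq_left]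
    intro z hz
    exact Finset.mem_union.2 (hmem z hz)
  have hI : (Y ∩ insert t P) ∩ (Y ∩ Q) = {a} := by
    ext z
    simp only [Finset.mem_inter, Finset.mem_insert, Finset.mem_singleton]
    constructor
    · rintro ⟨⟨hz, rfl | hzP⟩, -, hzQ⟩
      · exact absurd hzQ h.notMem_right
      · have : z ∈ P ∩ Q := Finset.mem_inter.2 ⟨hzP, hzQ⟩
        rw [hab, Finset.mem_insert, Finset.mem_singleton] at this
        rcases this with rfl | rfl
        · rfl
        · exact absurd hz hbY
    · rintro rfl
      exact ⟨⟨haY, Or.inr ha.1⟩, haY, ha.2⟩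
  have hc := Finset.card_union_add_card_inter (Y ∩ insert t P) (Y ∩ Q)
  rw [hU, hI, Finset.card_singleton] at hc
  have hw := (hmem w hwY).resolve_right hwQ
  have hA2 : 2 ≤ (Y ∩ insert t P).card := by
    rw [← Finset.card_pair (show a ≠ w by rintro rfl; exact hwQ ha.2)]
    apply Finset.card_le_card
    refine Finset.insert_subset ?_ (Finset.singleton_subset_iff.2 ?_)
    · exact Finset.mem_inter.2 ⟨haY, Finset.mem_insert_of_mem ha.1⟩
    · exact Finset.mem_inter.2 ⟨hwY, hw⟩
  have hC2 : 2 ≤ (Y ∩ Q).card := by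
    rw [← Finset.card_pair hxa]
    apply Finset.card_le_card
    refine Finset.insert_subset ?_ (Finset.singleton_subset_iff.2 ?_)
    · exact Finset.mem_inter.2 ⟨hxY, hxQ⟩
    · exact Finset.mem_inter.2 ⟨haY, ha.2⟩
  have hne : ∀ Z, Y ∩ Z ≠ V := fun Z heq => hbY
    (Finset.mem_inter.1 (heq ▸ h.subset_left hb.1 : b ∈ Y ∩ Z)).1
  have hsub : ∀ Z, Y ∩ Z ⊆ V := fun Z => Finset.inter_subset_left.trans hY.sub
  have nA := num_le hG (hsub _) (hne _) hA2
  have nC := num_le hG (hsub _) (hne _) hC2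
  have nY := hY.num_eq
  have hn : num E Y ≤ num E (Y ∩ insert t P) + num E (Y ∩ Q) + 1 := by
    have h1 : spans E Y ⊆ insert s(t, r) (spans E (Y ∩ insert t P) ∪ spans E (Y ∩ Q)) := by
      intro e
      induction e with | _ u v
      rw [Finset.mem_insert, Finset.mem_union, mem_spans, mem_spans, mem_spans]
      rintro ⟨huv, hu, hv⟩
      by_cases he : s(u, v) = s(t, r)
      · exact Or.inl he
      · simp only [Finset.mem_inter]
        rcases hedge u v huv he with h1 | h1
        · exact Or.inr (Or.inl ⟨huv, ⟨hu, h1.1⟩, hv, h1.2⟩)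
        · exact Or.inr (Or.inr ⟨huv, ⟨hu, h1.1⟩, hv, h1.2⟩)
    have h2 := Finset.card_le_card h1
    have h3 := Finset.card_insert_le s(t, r) (spans E (Y ∩ insert t P) ∪ spans E (Y ∩ Q))
    have h4 := Finset.card_union_le (spans E (Y ∩ insert t P)) (spans E (Y ∩ Q))
    unfold num
    omega
  refine ⟨?_, hsub _, hA2, by omega⟩
  by_contra htY
  have h1 := num_add_num_eq (E := E) (X := Y ∩ insert t P) (Y := Y ∩ Q) (by
    rw [hU]
    intro u hu v hv huv
    simp only [Finset.mem_inter]
    have hne : s(u, v) ≠ s(t, r) := by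
      rw [Ne, Sym2.eq_iff]
      rintro (⟨rfl, -⟩ | ⟨-, rfl⟩)
      · exact htY hu
      · exact htY hv
    have := hedge u v huv hne
    tauto)
  have h0 : num E {a} = 0 := num_eq_zero_of_card_le_one (loopless hG) (by simp)
  rw [hU, hI, h0] at h1
  omega

theorem not_both_blocked (h : Obstruction V E t p q r P Q) (hab : P ∩ Q = {a, b}) {t' : ℕ}
    (hN : Node E t' x a b) (htQ : t' ∈ Q) (htP : t' ∉ P) (hxQ : x ∈ Q) (hxd : dg E x V = 3)
    (hY : Crit V E Y) (hZ : Crit V E Z) (hxY : x ∈ Y) (haY : a ∈ Y) (htY : t' ∉ Y) (hbY : b ∉ Y)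
    (hxZ : x ∈ Z) (hbZ : b ∈ Z) (htZ : t' ∉ Z) (haZ : a ∉ Z) : False := by
  have hG := h.circuit
  have hab' : P ∩ Q = {b, a} := by rw [hab, Finset.pair_comm]
  obtain ⟨w₁, -, hw₁Q, hw₁⟩ := h.exists_nbr (show a ∈ P ∩ Q by simp [hab]) a
  obtain ⟨w₂, -, hw₂Q, hw₂⟩ := h.exists_nbr (show b ∈ P ∩ Q by simp [hab]) b
  have k := hN.two_le_inter hG h.not_sep h.five_le hxd hY hZ htY htZ hxY haY hxZ hbZ
  obtain ⟨hU, hno⟩ := hN.cover hG hY hZ htY htZ k (by simp [*]) (by simp [*]) (by simp [*])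
  have hmem : ∀ z ∈ V, z ≠ t' → z ∈ Y ∨ z ∈ Z := by
    intro z hz hne
    rw [← Finset.mem_union, hU]
    simp [hz, hne]
  have hw₁Y : w₁ ∈ Y := by
    by_contra hw
    have := hmem w₁ (mem_right hG hw₁) (by rintro rfl; exact hw₁Q htQ)
    exact hno a haY haZ w₁ (by tauto) hw hw₁
  have hw₂Z : w₂ ∈ Z := by
    by_contra hw
    have := hmem w₂ (mem_right hG hw₂) (by rintro rfl; exact hw₂Q htQ)
    exact hno w₂ (by tauto) hw b hbZ hbY (by rwa [Sym2.eq_swap])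
  obtain ⟨htY', hA⟩ := h.crit_inter_left hab hY haY hbY hxY hxQ hN.ab hw₁Y hw₁Q
  obtain ⟨htZ', hB⟩ := h.crit_inter_left hab' hZ hbZ haZ hxZ hxQ hN.ac hw₂Z hw₂Q
  have htt : t' ≠ t := by rintro rfl; exact htY htY'
  have htPt : t' ∉ insert t P := by simp [htt, htP]
  have hAB : (Y ∩ insert t P) ∪ (Z ∩ insert t P) = insert t P := by
    rw [← Finset.union_inter_distrib_right, Finset.inter_eq_right, hU]
    intro z hz
    simp only [Finset.mem_sdiff, Finset.mem_singleton]
    refine ⟨?_, by rintro rfl; exact htPt hz⟩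
    rcases Finset.mem_insert.1 hz with rfl | hz
    · exact (h.node.mem hG).1
    · exact h.subset_left hz
  have hP := h.num_left
  have hP3 := h.spec.2.2.1
  have hc := Finset.card_insert_of_notMem h.notMem_left
  have hd := h.dg_third
  have htA : t ∈ Y ∩ insert t P := by simp [htY']
  have htB : t ∈ Z ∩ insert t P := by simp [htZ']
  by_cases hI : 2 ≤ ((Y ∩ insert t P) ∩ (Z ∩ insert t P)).card
  · have h1 := (hA.union hB hG hI (by
      rw [hAB]
      intro heq
      exact htPt (heq ▸ (hN.mem hG).1))).1.num_eq
    rw [hAB, num_insert h.notMem_left (loopless hG t)] at h1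
    have := dg_mono (E := E) (v := t) (Finset.subset_insert t P)
    omega
  · have huniq : ∀ z ∈ Y ∩ insert t P, z ∈ Z ∩ insert t P → z = t := fun z hz hz' =>
      Finset.card_le_one.1 (by omega) z (Finset.mem_inter.2 ⟨hz, hz'⟩) t
        (Finset.mem_inter.2 ⟨htA, htB⟩)
    have h1 : dg E t ((Y ∩ insert t P) ∪ (Z ∩ insert t P).erase t) =
        dg E t (Y ∩ insert t P) + dg E t (Z ∩ insert t P) := by
      rw [dg_union_disjoint, dg_erase (loopless hG)]
      rw [Finset.disjoint_left]
      intro z hz hz'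
      rw [Finset.mem_erase] at hz'
      exact hz'.1 (huniq z hz hz'.2)
    have h2 : dg E t ((Y ∩ insert t P) ∪ (Z ∩ insert t P).erase t) ≤ dg E t (insert t P) :=
      dg_mono (Finset.union_subset Finset.inter_subset_right
        ((Finset.erase_subset _ _).trans Finset.inter_subset_right))
    have h3 := hA.one_le_dg hG htA
    have h4 := hB.one_le_dg hG htB
    have h5 : (Y ∩ insert t P).card ≤ 2 := by
      by_contra hlt
      have := hA.two_le_dg hG (by omega) htA
      omega
    have h6 : (Z ∩ insert t P).card ≤ 2 := by
      by_contra hlt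
      have := hB.two_le_dg hG (by omega) htB
      omega
    have h7 := Finset.card_union_add_card_inter (Y ∩ insert t P) (Z ∩ insert t P)
    rw [hAB] at h7
    have h8 := Finset.card_pos.2 ⟨t, Finset.mem_inter.2 ⟨htA, htB⟩⟩
    omega

theorem exists_adm_right (h : Obstruction V E t p q r P Q)
    (hmin : ∀ R S, Sep (V \ {t}) (reduce E t p q) R S → Q.card ≤ S.card) :
    ∃ t' ∈ Q, t' ∉ P ∧ t' ≠ r ∧ ∃ a b c, Node E t' a b c ∧ Adm V E t' a b c := by
  have hG := h.circuit
  obtain ⟨-, -, hP3, hQ3, hPQ, -⟩ := h.spec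
  obtain ⟨a, b, hab, hPQab⟩ := Finset.card_eq_two.1 hPQ
  have hF := h.isRigidityCircuit_right hPQab
  have hFS := h.not_sep_right hPQab hmin
  set F := spans E Q ∪ {s(a, b)} with hFdef
  have hEF : ∀ u v, u ∈ Q → v ∈ Q → s(u, v) ∈ E → s(u, v) ∈ F := fun u v hu hv huv =>
    Finset.mem_union_left _ (mem_spans.2 ⟨huv, hu, hv⟩)
  have hFE : ∀ u v, u ∉ P → s(u, v) ∈ F → s(u, v) ∈ E := by
    intro u v hu huv
    rw [hFdef, Finset.mem_union, mem_spans, Finset.mem_singleton] at huv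
    rcases huv with huv | huv
    · exact huv.1
    · have : u ∈ s(a, b) := by rw [← huv]; simp
      have : u ∈ P ∩ Q := by
        rw [hPQab]
        simpa using this
      exact absurd (Finset.mem_inter.1 this).1 hu
  have hnode : ∀ u x y z, u ∈ Q → u ∉ P → u ≠ r → Node F u x y z → Node E u x y z :=
    fun u x y z huQ huP hur hN => ⟨hN.ab, hN.ac, hN.bc, hFE _ _ huP hN.va, hFE _ _ huP hN.vb,
      hFE _ _ huP hN.vc, fun w hw => hN.eq w (hEF _ _ huQ (h.nbr_mem huQ huP hur hw) hw)⟩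
  by_cases hz : ∃ z ∈ Q, z ∉ P ∧ 4 ≤ dg F z Q
  · obtain ⟨z, hzQ, hzP, hzd⟩ := hz
    have hQ5 : 5 ≤ Q.card := by
      have h1 := dg_erase (v := z) (X := Q) (loopless hF)
      have h2 : dg F z (Q.erase z) ≤ (Q.erase z).card := Finset.card_filter_le _ _
      have h3 := Finset.card_erase_of_mem hzQ
      omega
    have hzab : z ∉ ({a, b} : Finset ℕ) := by
      rw [← hPQab, Finset.mem_inter]
      tauto
    obtain ⟨t', htQ, htab, htr, x, y, w, hN, hadm⟩ := exists_adm hF hFS hQ5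
      (crit_pair hF (a := a) (b := b) (by simp [hFdef])) hzQ hzab hzd r
    have htP : t' ∉ P := fun h1 => htab (hPQab ▸ Finset.mem_inter.2 ⟨h1, htQ⟩)
    have hN' := hnode t' x y w htQ htP htr hN
    exact ⟨t', htQ, htP, htr, x, y, w, hN', h.adm_of_adm_right hPQab hN' htQ
      (mem_right hF hN.va) (mem_right hF hN.vb) hadm⟩
  · push Not at hz
    have hd : ∀ v ∈ Q \ P, dg F v Q = 3 := by
      intro v hv
      rw [Finset.mem_sdiff] at hv
      have h1 := hz v hv.1 hv.2
      have h2 := three_le_dg hF hQ3 hv.1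
      omega
    have hrN : r ∈ Q \ P := Finset.mem_sdiff.2 ⟨h.third_mem, h.third_notMem⟩
    have hc := Finset.card_sdiff_add_card_inter Q P
    rw [Finset.inter_comm, hPQ] at hc
    have hN2 : 2 ≤ (Q \ P).card := by
      have h1 := dg_erase (v := r) (X := Q) (loopless hF)
      have h2 : dg F r (Q.erase r) ≤ (Q.erase r).card := Finset.card_filter_le _ _
      have h3 := Finset.card_erase_of_mem h.third_mem
      have h4 := hd r hrN
      omega
    obtain ⟨t', htN, htr, htd⟩ := exists_leaf hF Finset.sdiff_subset hd (by
      have := Finset.card_sdiff_add_card_eq_card (Finset.sdiff_subset : Q \ P ⊆ Q)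
      omega) hN2 r
    obtain ⟨htQ, htP⟩ := Finset.mem_sdiff.1 htN
    obtain ⟨_, _, _, hN₀⟩ := exists_node (hd t' htN) hF
    have htd' : dg E t' (Q \ P) ≤ 1 := by
      refine le_trans (Finset.card_le_card ?_) htd
      intro w
      simp only [Finset.mem_filter, Finset.mem_sdiff]
      exact fun hw => ⟨hw.1, hEF _ _ htQ hw.1.1 hw.2⟩
    obtain ⟨x, a', b', hN, hx, ha, hb⟩ := (hnode _ _ _ _ htQ htP htr hN₀).exists_of_dg_le_one
      htd' hPQ.le (by
        intro w hw hwN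
        have := h.nbr_mem htQ htP htr hw
        rw [Finset.mem_sdiff] at hwN
        exact Finset.mem_inter.2 ⟨by tauto, this⟩)
    have hPQab' : P ∩ Q = {a', b'} := by
      symm
      apply Finset.eq_of_subset_of_card_le
      · exact Finset.insert_subset ha (Finset.singleton_subset_iff.2 hb)
      · rw [hPQ, Finset.card_pair hN.bc]
    refine ⟨t', htQ, htP, htr, ?_⟩
    obtain ⟨hxQ, hxP⟩ := Finset.mem_sdiff.1 hx
    by_cases hxr : x = r
    · subst hxr
      refine ⟨a', b', x, hN.swap₁₂.swap₂₃, ?_⟩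
      intro Y hY haY hbY htY
      by_contra hxY
      have h1 := h.num_add_four_le (X := Q ∩ Y) Finset.inter_subset_left (by
        rw [hPQab']
        exact Finset.insert_subset (Finset.mem_inter.2 ⟨(Finset.mem_inter.1 ha).2, haY⟩)
          (Finset.singleton_subset_iff.2 (Finset.mem_inter.2 ⟨(Finset.mem_inter.1 hb).2, hbY⟩)))
        (fun heq => htY (Finset.inter_eq_left.1 heq htQ))
      have h2 := Finset.card_union_add_card_inter Q Y
      have h3 := num_add_num_le (E := E) (X := Q) (Y := Y)
      have e1 := h.crit_right.num_eq
      have e2 := hY.num_eq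
      have hU : Q ∪ Y = V := by
        by_contra hne
        have h4 := Finset.card_le_card (Finset.subset_union_left : Q ⊆ Q ∪ Y)
        have := num_le hG (Finset.union_subset h.subset_right hY.sub) hne (by omega)
        omega
      have htY' : t ∈ Y := by
        have : t ∈ Q ∪ Y := hU ▸ (h.node.mem hG).1
        exact (Finset.mem_union.1 this).resolve_left h.notMem_right
      have h5 := num_add_num_lt hxQ hxY htY' h.notMem_right
        (by rw [Sym2.eq_swap]; exact h.node.vc)
      have h6 := num_univ hG (by have := h.five_le; omega)
      rw [← hU] at h6
      omega
    · have hxd : dg E x V = 3 := by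
        apply le_antisymm
        · rw [← hd x hx]
          apply Finset.card_le_card
          intro w
          simp only [Finset.mem_filter]
          intro hw
          have := h.nbr_mem hxQ hxP hxr hw.2
          exact ⟨this, hEF _ _ hxQ this hw.2⟩
        · exact three_le_dg hG (by have := h.five_le; omega) (h.subset_right hxQ)
      by_contra! hno
      have hna := hno x a' b' hN
      have hnb := hno x b' a' hN.swap₂₃
      unfold Adm at hna hnb
      push Not at hna hnb
      obtain ⟨Y, hY, hxY, haY, htY, hbY⟩ := hna
      obtain ⟨Z, hZ, hxZ, hbZ, htZ, haZ⟩ := hnb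
      exact h.not_both_blocked hPQab' hN htQ htP hxQ hxd hY hZ hxY haY htY hbY hxZ hbZ htZ haZ

end Obstruction

theorem Node.obstruction (hN : Node E t a b c) (hG : IsRigidityCircuit V E)
    (hS : ∀ R S, ¬ Sep V E R S) (hV : 5 ≤ V.card) (hA : Adm V E t a b c)
    (h : Sep (V \ {t}) (reduce E t a b) R S) :
    Obstruction V E t a b c R S ∨ Obstruction V E t a b c S R := by
  rcases h.edge a b (mem_reduce.2 (Or.inr rfl)) with h1 | h1
  · exact Or.inl ⟨hG, hS, hV, hN, hA, h, h1.1, h1.2⟩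
  · exact Or.inr ⟨hG, hS, hV, hN, hA, h.symm, h1.1, h1.2⟩

theorem exists_four_le_dg (hG : IsRigidityCircuit V E) (hV : 5 ≤ V.card) :
    ∃ z ∈ V, 4 ≤ dg E z V := by
  by_contra! h
  have hd : ∀ v ∈ V, dg E v V = 3 := fun v hv =>
    le_antisymm (Nat.le_of_lt_succ (h v hv)) (three_le_dg hG (by omega) hv)
  have h1 : num E (∅ : Finset ℕ) = 0 := num_eq_zero_of_card_le_one (loopless hG) (by simp)
  have h2 := sum_dg (loopless hG) (Finset.Subset.refl V)
  have h3 := num_univ hG (by omega)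
  rw [Finset.sum_congr rfl hd, Finset.sum_const, smul_eq_mul, Finset.sdiff_self] at h2
  omega

theorem exists_node_adm (hG : IsRigidityCircuit V E) (hS : ∀ R S, ¬ Sep V E R S)
    (hV : 5 ≤ V.card) : ∃ t a b c, Node E t a b c ∧ Adm V E t a b c := by
  obtain ⟨z, hz, hzd⟩ := exists_four_le_dg hG hV
  have h1 := num_univ hG (by omega)
  have h2 := num_insert (Finset.notMem_erase z V) (loopless hG z)
  rw [Finset.insert_erase hz] at h2
  have h3 : dg E z (V.erase z) ≤ (V.erase z).card := Finset.card_filter_le _ _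
  have h4 := Finset.card_erase_of_mem hz
  have h5 : 0 < (spans E (V.erase z)).card := by
    unfold num at *
    omega
  obtain ⟨e, he⟩ := Finset.card_pos.1 h5
  induction e with | _ x y
  obtain ⟨hxy, hx, hy⟩ := mem_spans.1 he
  obtain ⟨t, -, -, -, a, b, c, hN, hA⟩ := exists_adm hG hS hV (crit_pair hG hxy) hz (by
    rw [Finset.mem_insert, Finset.mem_singleton]
    rintro (rfl | rfl)
    · exact Finset.notMem_erase _ _ hx
    · exact Finset.notMem_erase _ _ hy) hzd z
  exact ⟨t, a, b, c, hN, hA⟩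

theorem exists_node_adm_not_sep (hG : IsRigidityCircuit V E) (hS : ∀ R S, ¬ Sep V E R S)
    (hV : 5 ≤ V.card) : ∃ t a b c, Node E t a b c ∧ Adm V E t a b c ∧
      ∀ R S, ¬ Sep (V \ {t}) (reduce E t a b) R S := by
  by_contra! hno
  let p : ℕ → Prop := fun m => ∃ t a b c R S, Node E t a b c ∧ Adm V E t a b c ∧
    Sep (V \ {t}) (reduce E t a b) R S ∧ R.card = m
  have hp : ∃ m, p m := by
    obtain ⟨t, a, b, c, hN, hA⟩ := exists_node_adm hG hS hV
    obtain ⟨R, S, h⟩ := hno t a b c hN hA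
    exact ⟨_, t, a, b, c, R, S, hN, hA, h, rfl⟩
  have hmin : ∀ {t a b c R S}, Node E t a b c → Adm V E t a b c →
      Sep (V \ {t}) (reduce E t a b) R S → Nat.find hp ≤ R.card := fun hN hA h =>
    Nat.find_min' hp ⟨_, _, _, _, _, _, hN, hA, h, rfl⟩
  have hobs : ∀ {t a b c}, Node E t a b c → Adm V E t a b c → ∃ R S,
      Obstruction V E t a b c R S := by
    intro t a b c hN hA
    obtain ⟨R, S, h⟩ := hno t a b c hN hA
    rcases hN.obstruction hG hS hV hA h with h | h
    · exact ⟨R, S, h⟩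
    · exact ⟨S, R, h⟩
  obtain ⟨t, a, b, c, R, S, hN, hA, h, hR⟩ := Nat.find_spec hp
  rcases hN.obstruction hG hS hV hA h with h | h
  · obtain ⟨t', h1, h2, a', b', c', hN', hA'⟩ := h.exists_adm_left
    obtain ⟨R', S', h'⟩ := hobs hN' hA'
    exact h.not_left h' h1 h2 (hR.trans_le (hmin hN' hA' h'.sep))
      (hR.trans_le (hmin hN' hA' h'.sep.symm))
  · obtain ⟨t', h1, h2, h3, a', b', c', hN', hA'⟩ := h.exists_adm_right
      fun R' S' h' => hR.trans_le (hmin hN hA h'.symm)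
    obtain ⟨R', S', h'⟩ := hobs hN' hA'
    exact h.not_right h' h1 h2 h3 (hR.trans_le (hmin hN' hA' h'.sep))
      (hR.trans_le (hmin hN' hA' h'.sep.symm))

theorem Node.card_filter_mem (hN : Node E t a b c) : (E.filter (fun e => t ∈ e)).card = 3 := by
  have h : E.filter (fun e => t ∈ e) = {s(t, a), s(t, b), s(t, c)} := by
    ext e
    simp only [Finset.mem_filter, Finset.mem_insert, Finset.mem_singleton]
    constructor
    · rintro ⟨he, w, rfl⟩
      rcases hN.eq w he with rfl | rfl | rfl <;> simp
    · rintro (rfl | rfl | rfl)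
      · exact ⟨hN.va, Sym2.mem_mk_left _ _⟩
      · exact ⟨hN.vb, Sym2.mem_mk_left _ _⟩
      · exact ⟨hN.vc, Sym2.mem_mk_left _ _⟩
  rw [h, Finset.card_eq_three]
  exact ⟨_, _, _, mt Sym2.congr_right.1 hN.ab, mt Sym2.congr_right.1 hN.ac,
    mt Sym2.congr_right.1 hN.bc, rfl⟩

end RigidityCircuit

/-- Every 3-connected rigidity circuit with at least 5 vertices has an admissible pair:
a vertex `v` of degree 3 and a non-edge `{a, b}` with `a, b ∈ N(v)` such that
`G - v + ab` is a 3-connected rigidity circuit. -/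
theorem threeConnected_circuit_has_admissible_pair (V : Finset ℕ) (E : Finset (Sym2 ℕ))
    (hG : IsRigidityCircuit V E) (h3 : ThreeConnected V E) (hn : 5 ≤ V.card) :
    ∃ v ∈ V, ∃ a ∈ V, ∃ b ∈ V,
      (E.filter (fun e => v ∈ e)).card = 3 ∧
      a ≠ b ∧ s(a, b) ∉ E ∧ s(v, a) ∈ E ∧ s(v, b) ∈ E ∧
      IsRigidityCircuit (V \ {v}) (E.filter (fun e => v ∉ e) ∪ {s(a, b)}) ∧
      ThreeConnected (V \ {v}) (E.filter (fun e => v ∉ e) ∪ {s(a, b)}) := by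
  obtain ⟨t, a, b, c, hN, hA, hS⟩ := RigidityCircuit.exists_node_adm_not_sep hG
    (RigidityCircuit.ThreeConnected.not_sep h3) hn
  have hm := hN.mem hG
  have hF := hA.isRigidityCircuit hN hG
  refine ⟨t, hm.1, a, hm.2.1, b, hm.2.2.1, hN.card_filter_mem, hN.ab, hA.notMem hN hG, hN.va,
    hN.vb, hF, RigidityCircuit.threeConnected_of_not_sep hF ?_ hS⟩
  rw [Finset.card_sdiff_of_subset (Finset.singleton_subset_iff.2 hm.1), Finset.card_singleton]
  omega

end
end

section
/- Fix n ≥ 4 and let X_n = {x_{ij} : 1 ≤ i < j ≤ n}. Let C ⊆ X_n be a circuit of the algebraic rigidity matroid, i.e., CM_n ∩ ℚ[C] ≠ {0} while CM_n ∩ ℚ[C'] = {0} for every proper subset C' ⊊ C. Then the ideal CM_n ∩ ℚ[C] of the polynomial ring ℚ[C] is principal, and it is generated by a polynomial p_C that is irreducible over ℚ; moreover p_C is unique up to multiplication by a nonzero rational number. -/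
noncomputable section

/-- The set of variables `X_n = {x_{ij} : 1 ≤ i < j ≤ n}`, realized as unordered
pairs of distinct elements of `Fin n`. -/
abbrev XVar (n : ℕ) : Type := {e : Sym2 (Fin n) // ¬ e.IsDiag}

/-- The Cayley–Menger matrix on `n` points: the `(n+1) × (n+1)` symmetric matrix with
rows and columns indexed by `0, 1, …, n`, with entry `0` at `(0,0)`, entries `1` at
`(0,i)` and `(i,0)` for `i ≥ 1`, entries `0` on the diagonal, and variable `x_{ij}`
at positions `(i,j)` and `(j,i)` for distinct `i, j ≥ 1`. -/
def cmMatrix (n : ℕ) : Matrix (Fin (n + 1)) (Fin (n + 1)) (MvPolynomial (XVar n) ℚ) :=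
  Matrix.of fun i j =>
    if hij : i = j then 0
    else if hi : i = 0 then 1
    else if hj : j = 0 then 1
    else MvPolynomial.X ⟨s(i.pred hi, j.pred hj), by
      rw [Sym2.mk_isDiag_iff]
      exact fun h => hij (by
        have := congrArg (Fin.succ) h
        rwa [Fin.succ_pred, Fin.succ_pred] at this)⟩

/-- The Cayley–Menger ideal `CM_n ⊆ ℚ[X_n]`: the ideal generated by all `5 × 5`
minors of the Cayley–Menger matrix on `n` points. -/
def cmIdeal (n : ℕ) : Ideal (MvPolynomial (XVar n) ℚ) :=
  Ideal.span { p | ∃ (r c : Fin 5 → Fin (n + 1)),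
    Function.Injective r ∧ Function.Injective c ∧
    p = ((cmMatrix n).submatrix r c).det }

/-- `C ⊆ X_n` is a circuit of the algebraic rigidity matroid: `CM_n ∩ ℚ[C] ≠ {0}`
while `CM_n ∩ ℚ[C'] = {0}` for every proper subset `C' ⊊ C`. -/
def IsAlgCircuit (n : ℕ) (C : Set (XVar n)) : Prop :=
  (∃ p ∈ cmIdeal n, p ∈ MvPolynomial.supported ℚ C ∧ p ≠ 0) ∧
    ∀ C' ⊂ C, ∀ p ∈ cmIdeal n, p ∈ MvPolynomial.supported ℚ C' → p = 0

/-- The ideal `CM_n ∩ ℚ[C]` of the polynomial ring `ℚ[C]`. -/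
def cmRestrict (n : ℕ) (C : Set (XVar n)) : Ideal (MvPolynomial.supported ℚ C) :=
  (cmIdeal n).comap (MvPolynomial.supported ℚ C).val.toRingHom

/-- The commutative ring structure on `R × M` with product
`(a, m) * (b, n) = (a * b + β m n, a • n + b • m)`. -/
abbrev commRingOfBilin {R M : Type*} [CommRing R] [AddCommGroup M] [Module R M]
    (β : M →ₗ[R] M →ₗ[R] R) (hsymm : ∀ m n, β m n = β n m)
    (hassoc : ∀ l m n, β l m • n = β m n • l) : CommRing (R × M) where
  __ := (inferInstance : AddCommGroup (R × M))
  mul x y := (x.1 * y.1 + β x.2 y.2, x.1 • y.2 + y.1 • x.2)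
  one := (1, 0)
  left_distrib x y z := by
    refine Prod.ext ?_ ?_
    · change x.1 * (y.1 + z.1) + β x.2 (y.2 + z.2) =
        (x.1 * y.1 + β x.2 y.2) + (x.1 * z.1 + β x.2 z.2)
      rw [map_add]; ring
    · change x.1 • (y.2 + z.2) + (y.1 + z.1) • x.2 =
        (x.1 • y.2 + y.1 • x.2) + (x.1 • z.2 + z.1 • x.2)
      module
  right_distrib x y z := by
    refine Prod.ext ?_ ?_
    · change (x.1 + y.1) * z.1 + β (x.2 + y.2) z.2 =
        (x.1 * z.1 + β x.2 z.2) + (y.1 * z.1 + β y.2 z.2)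
      rw [map_add, LinearMap.add_apply]; ring
    · change (x.1 + y.1) • z.2 + z.1 • (x.2 + y.2) =
        (x.1 • z.2 + z.1 • x.2) + (y.1 • z.2 + z.1 • y.2)
      module
  zero_mul x := by
    refine Prod.ext ?_ ?_
    · change 0 * x.1 + β 0 x.2 = 0
      simp
    · change (0 : R) • x.2 + x.1 • (0 : M) = 0
      simp
  mul_zero x := by
    refine Prod.ext ?_ ?_
    · change x.1 * 0 + β x.2 0 = 0
      simp
    · change x.1 • (0 : M) + (0 : R) • x.2 = 0
      simp
  mul_assoc x y z := by
    refine Prod.ext ?_ ?_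
    · change (x.1 * y.1 + β x.2 y.2) * z.1 + β (x.1 • y.2 + y.1 • x.2) z.2 =
        x.1 * (y.1 * z.1 + β y.2 z.2) + β x.2 (y.1 • z.2 + z.1 • y.2)
      simp only [map_add, map_smul, LinearMap.add_apply, LinearMap.smul_apply, smul_eq_mul]
      ring
    · change (x.1 * y.1 + β x.2 y.2) • z.2 + z.1 • (x.1 • y.2 + y.1 • x.2) =
        x.1 • (y.1 • z.2 + z.1 • y.2) + (y.1 * z.1 + β y.2 z.2) • x.2
      linear_combination (norm := module) hassoc x.2 y.2 z.2
  one_mul x := by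
    refine Prod.ext ?_ ?_
    · change 1 * x.1 + β 0 x.2 = x.1
      simp
    · change (1 : R) • x.2 + x.1 • (0 : M) = x.2
      simp
  mul_one x := by
    refine Prod.ext ?_ ?_
    · change x.1 * 1 + β x.2 0 = x.1
      simp
    · change x.1 • (0 : M) + (1 : R) • x.2 = x.2
      simp
  mul_comm x y := by
    refine Prod.ext ?_ ?_
    · change x.1 * y.1 + β x.2 y.2 = y.1 * x.1 + β y.2 x.2
      rw [hsymm, mul_comm]
    · change x.1 • y.2 + y.1 • x.2 = y.1 • x.2 + x.1 • y.2
      exact add_comm _ _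

/-- The form on a module modulo its radical. -/
lemma exists_bilin_quotient {R F : Type*} [CommRing R] [AddCommGroup F] [Module R F]
    (B : F →ₗ[R] F →ₗ[R] R) (hsymm : ∀ m n, B m n = B n m) :
    ∃ β : (F ⧸ LinearMap.ker B) →ₗ[R] (F ⧸ LinearMap.ker B) →ₗ[R] R,
      ∀ m n, β (Submodule.Quotient.mk m) (Submodule.Quotient.mk n) = B m n := by
  have h : LinearMap.ker B ≤ LinearMap.ker ((LinearMap.ker B).liftQ B le_rfl).flip := by
    intro n hn
    rw [LinearMap.mem_ker] at hn ⊢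
    ext m
    simp [hsymm m n, hn]
  exact ⟨(LinearMap.ker B).liftQ _ h, fun m n => by simp [hsymm n m]⟩

/-- If all `3 × 3` minors of a symmetric matrix over `R` vanish, then over a ring containing `R`
the matrix is the symmetrization of a matrix with vanishing `2 × 2` minors. -/
lemma exists_symmetrization {R ι : Type} [CommRing R] [Algebra ℚ R] (g : ι → ι → R)
    (hg : ∀ i j, g i j = g j i)
    (hdet : ∀ a b c d e f : ι, g a d * (g b e * g c f - g b f * g c e)
      - g a e * (g b d * g c f - g b f * g c d) + g a f * (g b d * g c e - g b e * g c d) = 0) :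
    ∃ (T : Type) (_ : CommRing T) (φ : R →+* T) (y : ι × ι → T), Function.Injective φ ∧
      (∀ i j k l, y (i, j) * y (k, l) = y (i, l) * y (k, j)) ∧
      ∀ i j, y (i, j) + y (j, i) = φ (g i j) := by
  classical
  let b : ι × ι → ι × ι → R := fun p q => g p.1 q.2 * g p.2 q.1 - g p.1 q.1 * g p.2 q.2
  let B : (ι × ι →₀ R) →ₗ[R] (ι × ι →₀ R) →ₗ[R] R :=
    Finsupp.linearCombination R fun p => Finsupp.linearCombination R (b p)
  have hB (p q : ι × ι) (r s : R) : B (.single p r) (.single q s) = r * (s * b p q) := by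
    simp [B]
  have hb (p q : ι × ι) : b p q = b q p := by
    simp only [b, hg q.1, hg q.2]; ring
  have hsymm (m n) : B m n = B n m := by
    induction m using Finsupp.induction_linear with
    | zero => simp
    | add m m' h h' => simp [h, h']
    | single p r =>
      induction n using Finsupp.induction_linear with
      | zero => simp
      | add n n' h h' => simp [h, h']
      | single q s => rw [hB, hB, hb]; ring
  have hbb (p q r s : ι × ι) : b p q * b r s = b q r * b p s := by
    obtain ⟨i, j⟩ := p
    obtain ⟨k, l⟩ := q
    obtain ⟨p, q⟩ := r
    obtain ⟨r, s⟩ := s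
    simp only [b]
    have h1 := hdet j p q l r s
    have h2 := hdet i p q l r s
    have h3 := hdet i j q k r s
    have h4 := hdet i j p k r s
    rw [hg k q, hg k p, hg l p, hg l q]
    linear_combination g i k * h1 - g j k * h2 + g p l * h3 - g q l * h4
  have hBB (a c d e) : B a c * B d e = B c d * B a e := by
    induction a using Finsupp.induction_linear with
    | zero => simp
    | add m m' h h' => simp only [map_add, LinearMap.add_apply]; linear_combination h + h'
    | single p r =>
    induction c using Finsupp.induction_linear with
    | zero => simp
    | add m m' h h' => simp only [map_add, LinearMap.add_apply]; linear_combination h + h'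
    | single q s =>
    induction d using Finsupp.induction_linear with
    | zero => simp
    | add m m' h h' => simp only [map_add, LinearMap.add_apply]; linear_combination h + h'
    | single u t =>
    induction e using Finsupp.induction_linear with
    | zero => simp
    | add m m' h h' => simp only [map_add]; linear_combination h + h'
    | single w z =>
      simp only [hB]
      linear_combination r * s * t * z * hbb p q u w
  obtain ⟨β, hβ⟩ := exists_bilin_quotient B hsymm
  let M := (ι × ι →₀ R) ⧸ LinearMap.ker B
  have hβsymm (m n : M) : β m n = β n m := by
    obtain ⟨m, rfl⟩ := Submodule.Quotient.mk_surjective _ m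
    obtain ⟨n, rfl⟩ := Submodule.Quotient.mk_surjective _ n
    rw [hβ, hβ, hsymm]
  have hβassoc (l m n : M) : β l m • n = β m n • l := by
    obtain ⟨l, rfl⟩ := Submodule.Quotient.mk_surjective _ l
    obtain ⟨m, rfl⟩ := Submodule.Quotient.mk_surjective _ m
    obtain ⟨n, rfl⟩ := Submodule.Quotient.mk_surjective _ n
    rw [hβ, hβ, ← Submodule.Quotient.mk_smul, ← Submodule.Quotient.mk_smul,
      Submodule.Quotient.eq, LinearMap.mem_ker]
    ext1 q
    ext1
    simp [hBB l m n]
  let δ : ι × ι → M := fun p => Submodule.Quotient.mk (.single p 1)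
  have hβδ (p q) : β (δ p) (δ q) = b p q := by rw [hβ, hB]; ring
  have hδ (i j) : δ (i, j) + δ (j, i) = 0 := by
    rw [← Submodule.Quotient.mk_add, Submodule.Quotient.mk_eq_zero, LinearMap.mem_ker]
    ext ⟨k, l⟩
    simp only [map_add, LinearMap.add_apply, LinearMap.comp_apply, Finsupp.lsingle_apply, hB,
      LinearMap.zero_apply, b]
    ring
  have hδδ (i j k l) : g i j • δ (k, l) + g k l • δ (i, j) =
      g i l • δ (k, j) + g k j • δ (i, l) := by
    simp only [δ]
    rw [← Submodule.Quotient.mk_smul, ← Submodule.Quotient.mk_smul, ← Submodule.Quotient.mk_smul,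
      ← Submodule.Quotient.mk_smul, ← Submodule.Quotient.mk_add, ← Submodule.Quotient.mk_add,
      Submodule.Quotient.eq, LinearMap.mem_ker]
    ext ⟨r, s⟩
    simp only [map_add, map_sub, map_smul, LinearMap.add_apply, LinearMap.sub_apply,
      LinearMap.smul_apply, LinearMap.comp_apply, Finsupp.lsingle_apply, hB,
      LinearMap.zero_apply, b, smul_eq_mul]
    rw [hg k j, hg k l]
    have h1 := hdet k l j i r s
    have h2 := hdet i j l k r s
    rw [hg l k, hg j i, hg l i, hg k i, hg j k] at *
    linear_combination - h1 - h2
  let h : R := algebraMap ℚ R (1 / 2)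
  have hh : h + h = 1 := by rw [← map_add]; norm_num
  let := commRingOfBilin β hβsymm hβassoc
  have fst_mul (x y : R × M) : (x * y).1 = x.1 * y.1 + β x.2 y.2 := rfl
  have snd_mul (x y : R × M) : (x * y).2 = x.1 • y.2 + y.1 • x.2 := rfl
  let φ : R →+* R × M :=
    { toFun := fun a => (a, 0)
      map_zero' := rfl
      map_one' := rfl
      map_add' := fun a b => Prod.ext rfl (add_zero (0 : M)).symm
      map_mul' := fun a b => Prod.ext (by simp [fst_mul]) (by simp [snd_mul]) }
  refine ⟨R × M, inferInstance, φ, fun p => (h * g p.1 p.2, h • δ p), ?_, ?_, ?_⟩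
  · intro a b hab
    exact congrArg Prod.fst hab
  · intro i j k l
    refine Prod.ext ?_ ?_
    · simp only [fst_mul, map_smul, LinearMap.smul_apply, hβδ, b, smul_eq_mul]
      rw [hg l k, hg l j, hg k j]
      ring
    · simp only [snd_mul]
      linear_combination (norm := module) (h * h) • hδδ i j k l
  · intro i j
    refine Prod.ext ?_ ?_
    · change h * g i j + h * g j i = g i j
      rw [hg j i]; linear_combination g i j * hh
    · change h • δ (i, j) + h • δ (j, i) = 0
      rw [← smul_add, hδ, smul_zero]

lemma prod_map_eq_of_swap {T ι : Type*} [CommMonoid T] (y : ι × ι → T)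
    (hy : ∀ i j k l, y (i, j) * y (k, l) = y (i, l) * y (k, j)) (s t : Multiset (ι × ι))
    (h₁ : s.map Prod.fst = t.map Prod.fst) (h₂ : s.map Prod.snd = t.map Prod.snd) :
    (s.map y).prod = (t.map y).prod := by
  classical
  induction s using Multiset.induction_on generalizing t with
  | empty =>
    have : t = 0 := by simpa using h₁.symm
    rw [this]
  | cons p s ih =>
    obtain ⟨i, j⟩ := p
    have hi : i ∈ t.map Prod.fst := h₁ ▸ by simp
    have hj : j ∈ t.map Prod.snd := h₂ ▸ by simp
    by_cases hij : (i, j) ∈ t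
    · obtain ⟨t, rfl⟩ := Multiset.exists_cons_of_mem hij
      simp only [Multiset.map_cons, Multiset.cons_inj_right, Multiset.prod_cons] at h₁ h₂ ⊢
      rw [ih t h₁ h₂]
    · obtain ⟨⟨i', l⟩, hil, rfl⟩ := Multiset.mem_map.1 hi
      obtain ⟨⟨k, j'⟩, hkj, rfl⟩ := Multiset.mem_map.1 hj
      dsimp only at *
      obtain ⟨t, rfl⟩ := Multiset.exists_cons_of_mem hil
      have hkj : (k, j') ∈ t := by
        rcases Multiset.mem_cons.1 hkj with h | h
        · cases h
          exact absurd hil hij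
        · exact h
      obtain ⟨t, rfl⟩ := Multiset.exists_cons_of_mem hkj
      have := ih ((k, l) ::ₘ t) (by simpa using h₁) (by
        simp only [Multiset.map_cons] at h₂ ⊢
        rw [Multiset.cons_swap] at h₂
        simpa using h₂)
      simp only [Multiset.map_cons, Multiset.prod_cons] at this ⊢
      rw [this, ← mul_assoc, ← mul_assoc, hy]

/-- A relation among the monomials `u i * v j` holds for every family satisfying the
`2 × 2` minor relations. -/
lemma eval₂_eq_zero_of_swap {T ι : Type*} [CommRing T] (r : ℚ →+* T) (y : ι × ι → T)
    (hy : ∀ i j k l, y (i, j) * y (k, l) = y (i, l) * y (k, j)) (f : MvPolynomial (ι × ι) ℚ)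
    (hf : MvPolynomial.aeval (fun p : ι × ι => (MvPolynomial.X (Sum.inl p.1) *
      MvPolynomial.X (Sum.inr p.2) : MvPolynomial (ι ⊕ ι) ℚ)) f = 0) :
    MvPolynomial.eval₂ r y f = 0 := by
  classical
  let : Algebra ℚ T := r.toAlgebra
  let e : Multiset (ι × ι) → (ι ⊕ ι →₀ ℕ) := fun s =>
    Multiset.toFinsupp (s.map (Sum.inl ∘ Prod.fst) + s.map (Sum.inr ∘ Prod.snd))
  have he {s t : Multiset (ι × ι)} (h : e s = e t) : (s.map y).prod = (t.map y).prod := by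
    have h := Multiset.toFinsupp.injective h
    have hn (s : Multiset (ι × ι)) : s.filterMap (fun _ => (none : Option ι)) = 0 := by
      induction s using Multiset.induction_on <;> simp [*]
    have hm (f : ι × ι → ι) (s : Multiset (ι × ι)) : s.filterMap (fun x => some (f x)) = s.map f :=
      congrFun (Multiset.filterMap_eq_map f) s
    refine prod_map_eq_of_swap y hy s t ?_ ?_
    · simpa [hn, hm, Multiset.filterMap_map, Function.comp_def, Multiset.filterMap_add] using
        congrArg (Multiset.filterMap Sum.getLeft?) h
    · simpa [hn, hm, Multiset.filterMap_map, Function.comp_def, Multiset.filterMap_add] using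
        congrArg (Multiset.filterMap Sum.getRight?) h
  let φ := MvPolynomial.aeval (R := ℚ) (fun p : ι × ι => (MvPolynomial.X (Sum.inl p.1) *
      MvPolynomial.X (Sum.inr p.2) : MvPolynomial (ι ⊕ ι) ℚ))
  have hφ (s : Multiset (ι × ι)) : φ (s.map MvPolynomial.X).prod = MvPolynomial.monomial (e s) 1 := by
    induction s using Multiset.induction_on with
    | empty => simp [e]
    | cons p s ih =>
      have hadd : e (p ::ₘ s) = (.single (Sum.inl p.1) 1 + .single (Sum.inr p.2) 1) + e s := by
        apply Multiset.toFinsupp.symm.injective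
        simp [e, ← Multiset.singleton_add]
        abel
      rw [Multiset.map_cons, Multiset.prod_cons, map_mul, ih, hadd]
      rw [MvPolynomial.aeval_X, MvPolynomial.X, MvPolynomial.X, MvPolynomial.monomial_mul,
        MvPolynomial.monomial_mul, one_mul, one_mul]
  let Λ : MvPolynomial (ι ⊕ ι) ℚ →ₗ[ℚ] T := (MvPolynomial.basisMonomials (ι ⊕ ι) ℚ).constr ℚ
    fun d => if h : ∃ s, e s = d then (h.choose.map y).prod else 0
  have hΛ : Λ ∘ₗ φ.toLinearMap = (MvPolynomial.aeval y).toLinearMap := by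
    refine (MvPolynomial.basisMonomials (ι × ι) ℚ).ext fun m => ?_
    have hm : MvPolynomial.monomial m (1 : ℚ) = (m.toMultiset.map MvPolynomial.X).prod := by
      rw [MvPolynomial.monomial_eq, Finsupp.toMultiset_map, Finsupp.prod_toMultiset]
      simp [Finsupp.prod_mapDomain_index, pow_add]
    have h : ∃ s, e s = e m.toMultiset := ⟨_, rfl⟩
    rw [MvPolynomial.coe_basisMonomials]
    dsimp only
    rw [hm, LinearMap.comp_apply, AlgHom.toLinearMap_apply, hφ,
      AlgHom.toLinearMap_apply, map_multiset_prod, Multiset.map_map]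
    have hc := (MvPolynomial.basisMonomials (ι ⊕ ι) ℚ).constr_basis ℚ
      (fun d => if h : ∃ s, e s = d then (h.choose.map y).prod else 0) (e m.toMultiset)
    rw [MvPolynomial.coe_basisMonomials, dif_pos h] at hc
    simpa [Function.comp_def] using hc.trans (he h.choose_spec)
  have hy0 : Λ (φ f) = MvPolynomial.aeval y f := congrArg (fun F => F f) hΛ
  rw [show φ f = 0 from hf, map_zero] at hy0
  exact hy0.symm

/-- A nonzero prime ideal of `A[X]` contracting to `0` in `A` is generated by a prime element. -/
lemma exists_prime_span_of_comap_C_eq_bot {A : Type*} [CommRing A] [IsDomain A]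
    [UniqueFactorizationMonoid A] (P : Ideal (Polynomial A)) (hP : P.IsPrime) (hne : P ≠ ⊥)
    (hC : ∀ a : A, Polynomial.C a ∈ P → a = 0) : ∃ p, Prime p ∧ P = Ideal.span {p} := by
  classical
  obtain ⟨p, hpP, hp⟩ := hP.exists_mem_prime_of_ne_bot hne
  refine ⟨p, hp, le_antisymm (fun q hq => ?_) ((Ideal.span_singleton_le_iff_mem _).2 hpP)⟩
  rw [Ideal.mem_span_singleton]
  have hdeg : p.natDegree ≠ 0 := by
    intro h
    rw [Polynomial.eq_C_of_natDegree_eq_zero h] at hpP hp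
    exact hp.ne_zero (by rw [hC _ hpP, map_zero])
  let := UniqueFactorizationMonoid.toGCDMonoid A
  let : NormalizedGCDMonoid A := Nonempty.some inferInstance
  have hprim : p.IsPrimitive := hp.irreducible.isPrimitive hdeg
  let K := FractionRing A
  have hirr : Irreducible (p.map (algebraMap A K)) :=
    (hprim.irreducible_iff_irreducible_map_fraction_map).1 hp.irreducible
  by_contra hpq
  have hcop : IsCoprime (p.map (algebraMap A K)) (q.map (algebraMap A K)) :=
    hirr.coprime_iff_not_dvd.2 fun h => hpq (hprim.dvd_of_fraction_map_dvd_fraction_map h)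
  obtain ⟨a, c, hac⟩ := hcop
  obtain ⟨s, hs, has⟩ := IsLocalization.integerNormalization_spec (nonZeroDivisors A) a
  obtain ⟨t, ht, hct⟩ := IsLocalization.integerNormalization_spec (nonZeroDivisors A) c
  set a' := IsLocalization.integerNormalization (nonZeroDivisors A) a
  set c' := IsLocalization.integerNormalization (nonZeroDivisors A) c
  have key : Polynomial.C (s * t) = Polynomial.C t * a' * p + Polynomial.C s * c' * q := by
    apply Polynomial.map_injective _ (IsFractionRing.injective A K)
    simp only [Polynomial.map_add, Polynomial.map_mul, has, hct, Polynomial.map_C, map_mul,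
      Algebra.smul_def, Polynomial.algebraMap_apply]
    linear_combination (-Polynomial.C (algebraMap A K s) * Polynomial.C (algebraMap A K t)) * hac
  have := hC (s * t) (key ▸ P.add_mem (P.mul_mem_left _ hpP) (P.mul_mem_left _ hq))
  exact mul_ne_zero (nonZeroDivisors.ne_zero hs) (nonZeroDivisors.ne_zero ht) this

lemma cayleyMenger_det_eq {R : Type*} [CommRing R] (p q : Fin 3 → R) (m : Fin 3 → Fin 3 → R) :
    Matrix.det !![0, 1, 1, 1, 1; 1, 0, p 0, p 1, p 2; 1, q 0, m 0 0, m 0 1, m 0 2;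
      1, q 1, m 1 0, m 1 1, m 1 2; 1, q 2, m 2 0, m 2 1, m 2 2] =
    Matrix.det (Matrix.of fun i j => q i + p j - m i j) := by
  simp [Matrix.det_succ_row_zero, Fin.sum_univ_succ, Fin.succAbove]
  ring

lemma det_submatrix_mem_cmIdeal (n : ℕ) (r c : Fin 5 → Fin (n + 1)) :
    ((cmMatrix n).submatrix r c).det ∈ cmIdeal n := by
  by_cases hr : Function.Injective r
  · by_cases hc : Function.Injective c
    · exact Ideal.subset_span ⟨r, c, hr, hc, rfl⟩
    · obtain ⟨i, j, hij, hne⟩ := Function.not_injective_iff.1 hc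
      rw [Matrix.det_zero_of_column_eq hne fun k => by simp [hij]]
      exact zero_mem _
  · obtain ⟨i, j, hij, hne⟩ := Function.not_injective_iff.1 hr
    rw [Matrix.det_zero_of_row_eq hne (by ext k; simp [hij])]
    exact zero_mem _

/-- The parametrization `x_{ij} ↦ (u_i - u_j) (v_i - v_j)`. -/
def cmParam (n : ℕ) : MvPolynomial (XVar n) ℚ →ₐ[ℚ] MvPolynomial (Fin n ⊕ Fin n) ℚ :=
  MvPolynomial.aeval fun e => Sym2.lift ⟨fun i j =>
    (MvPolynomial.X (Sum.inl i) - MvPolynomial.X (Sum.inl j)) *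
      (MvPolynomial.X (Sum.inr i) - MvPolynomial.X (Sum.inr j)), fun i j => by ring⟩ e.1

lemma cmMatrix_succ_succ_of_ne {n : ℕ} {i j : Fin n} (h : i ≠ j) :
    cmMatrix n i.succ j.succ = MvPolynomial.X ⟨s(i, j), by simpa using h⟩ := by
  simp [cmMatrix, h]

lemma cmMatrix_succ_self (n : ℕ) (i : Fin (n + 1)) : cmMatrix n i i = 0 := by simp [cmMatrix]

lemma cmMatrix_zero_succ (n : ℕ) (i : Fin n) : cmMatrix n 0 i.succ = 1 := by
  simp [cmMatrix, (Fin.succ_ne_zero i).symm]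

lemma cmMatrix_succ_zero (n : ℕ) (i : Fin n) : cmMatrix n i.succ 0 = 1 := by
  simp [cmMatrix]

lemma cmMatrix_comm (n : ℕ) (i j : Fin n) :
    cmMatrix n i.succ j.succ = cmMatrix n j.succ i.succ := by
  by_cases h : i = j
  · rw [h]
  · rw [cmMatrix_succ_succ_of_ne h, cmMatrix_succ_succ_of_ne (Ne.symm h)]
    congr 2
    exact Sym2.eq_swap

lemma cmParam_cmMatrix (n : ℕ) (i j : Fin n) : cmParam n (cmMatrix n i.succ j.succ) =
    (MvPolynomial.X (Sum.inl i) - MvPolynomial.X (Sum.inl j)) *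
      (MvPolynomial.X (Sum.inr i) - MvPolynomial.X (Sum.inr j)) := by
  by_cases h : i = j
  · simp [h, cmMatrix_succ_self]
  · rw [cmMatrix_succ_succ_of_ne h, cmParam, MvPolynomial.aeval_X]
    simp

lemma cmIdeal_le_ker (n : ℕ) : cmIdeal n ≤ RingHom.ker (cmParam n) := by
  rw [cmIdeal, Ideal.span_le]
  rintro _ ⟨r, c, -, -, rfl⟩
  let u : Fin n → MvPolynomial (Fin n ⊕ Fin n) ℚ := fun i => MvPolynomial.X (Sum.inl i)
  let v : Fin n → MvPolynomial (Fin n ⊕ Fin n) ℚ := fun i => MvPolynomial.X (Sum.inr i)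
  let A : Fin (n + 1) → Fin 5 → MvPolynomial (Fin n ⊕ Fin n) ℚ :=
    Fin.cons ![0, 0, 1, 0, 0] fun i => ![0, 1, u i * v i, u i, v i]
  let B : Fin (n + 1) → Fin 5 → MvPolynomial (Fin n ⊕ Fin n) ℚ :=
    Fin.cons ![0, 1, 0, 0, 0] fun i => ![0, u i * v i, 1, -v i, -u i]
  have hAB (i j) : cmParam n (cmMatrix n i j) = ∑ k, A i k * B j k := by
    cases i using Fin.cases <;> cases j using Fin.cases <;>
    simp [A, B, u, v, Fin.sum_univ_succ, cmParam_cmMatrix, cmMatrix_succ_self, cmMatrix_zero_succ,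
      cmMatrix_succ_zero]
    ring
  have hA (i) : A i 0 = 0 := by cases i using Fin.cases <;> simp [A]
  have h : (cmParam n).mapMatrix ((cmMatrix n).submatrix r c) =
      (Matrix.of fun i k => A (r i) k) * (Matrix.of fun k j => B (c j) k) := by
    ext1 i j
    simp [hAB, Matrix.mul_apply]
  rw [SetLike.mem_coe, RingHom.mem_ker, AlgHom.map_det, h, Matrix.det_mul,
    Matrix.det_eq_zero_of_column_eq_zero (A := Matrix.of fun i k => A (r i) k) 0 fun i => hA (r i),
    zero_mul]

lemma ker_le_cmIdeal {n : ℕ} (o : Fin n) : RingHom.ker (cmParam n) ≤ cmIdeal n := by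
  intro f hf
  let R := MvPolynomial (XVar n) ℚ ⧸ cmIdeal n
  let d : Fin n → Fin n → R := fun i j => Ideal.Quotient.mk _ (cmMatrix n i.succ j.succ)
  have hd (i j) : d i j = d j i := by simp only [d, cmMatrix_comm n i j]
  have hdd (i) : d i i = 0 := by simp only [d, cmMatrix_succ_self, map_zero]
  let g : Fin n → Fin n → R := fun i j => d i o + d o j - d i j
  obtain ⟨T, _, ψ, y, hψ, hy, hyg⟩ := exists_symmetrization g
    (fun i j => by simp only [g, hd o, hd i j]; ring) (by
      intro a b c a' b' c'
      have h := Ideal.Quotient.eq_zero_iff_mem.2 (det_submatrix_mem_cmIdeal n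
        ![0, o.succ, a.succ, b.succ, c.succ] ![0, o.succ, a'.succ, b'.succ, c'.succ])
      have hM : (Ideal.Quotient.mk (cmIdeal n)).mapMatrix ((cmMatrix n).submatrix
          ![0, o.succ, a.succ, b.succ, c.succ] ![0, o.succ, a'.succ, b'.succ, c'.succ]) =
          !![0, 1, 1, 1, 1; 1, 0, d o a', d o b', d o c'; 1, d a o, d a a', d a b', d a c';
            1, d b o, d b a', d b b', d b c'; 1, d c o, d c a', d c b', d c c'] := by
        ext i j
        rw [RingHom.mapMatrix_apply, Matrix.map_apply, Matrix.submatrix_apply]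
        fin_cases i <;> fin_cases j <;>
        simp [d, cmMatrix_succ_self, cmMatrix_zero_succ, cmMatrix_succ_zero]
      rw [RingHom.map_det, hM] at h
      have h' := (cayleyMenger_det_eq ![d o a', d o b', d o c'] ![d a o, d b o, d c o]
        ![![d a a', d a b', d a c'], ![d b a', d b b', d b c'], ![d c a', d c b', d c c']]).symm.trans h
      rw [Matrix.det_fin_three] at h'
      simp only [Matrix.of_apply, Matrix.cons_val] at h'
      simp only [g]
      linear_combination h')
  let η : MvPolynomial (XVar n) ℚ →ₐ[ℚ] MvPolynomial (Fin n × Fin n) ℚ :=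
    MvPolynomial.aeval fun e => Sym2.lift ⟨fun i j => MvPolynomial.X (i, i) + MvPolynomial.X (j, j)
      - (MvPolynomial.X (i, j) + MvPolynomial.X (j, i)), fun i j => by ring⟩ e.1
  let θ : MvPolynomial (Fin n × Fin n) ℚ →+* T :=
    MvPolynomial.eval₂Hom (ψ.comp (algebraMap ℚ R)) y
  have h1 : cmParam n = (MvPolynomial.aeval (fun p : Fin n × Fin n => (MvPolynomial.X (Sum.inl p.1) *
      MvPolynomial.X (Sum.inr p.2) : MvPolynomial (Fin n ⊕ Fin n) ℚ))).comp η := by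
    refine MvPolynomial.algHom_ext fun ⟨e, he⟩ => ?_
    induction e with | _ i j
    simp only [cmParam, η, MvPolynomial.aeval_X, AlgHom.comp_apply, Sym2.lift_mk, map_add, map_sub]
    ring
  have h2 : θ.comp η.toRingHom = ψ.comp (Ideal.Quotient.mk (cmIdeal n)) := by
    refine MvPolynomial.ringHom_ext (fun r => ?_) fun ⟨e, he⟩ => ?_
    · simp [θ, η]
      rfl
    · induction e with | _ i j
      have hij : i ≠ j := by simpa using he
      have hx : Ideal.Quotient.mk (cmIdeal n) (MvPolynomial.X ⟨s(i, j), he⟩) = d i j := by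
        simp only [d, cmMatrix_succ_succ_of_ne hij]
      have hη : η (MvPolynomial.X ⟨s(i, j), he⟩) = MvPolynomial.X (i, i) + MvPolynomial.X (j, j)
          - (MvPolynomial.X (i, j) + MvPolynomial.X (j, i)) := by
        simp [η]
      have hdiag (i : Fin n) : y (i, i) = ψ (d i o) := by
        have h := hyg i i
        simp only [g, hdd, hd o i, sub_zero, map_add] at h
        have h2 : ψ (algebraMap ℚ R (1 / 2)) + ψ (algebraMap ℚ R (1 / 2)) = 1 := by
          rw [← map_add, ← map_add]
          norm_num
        linear_combination (ψ (algebraMap ℚ R (1 / 2))) * h + (ψ (d i o) - y (i, i)) * h2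
      change θ (η _) = ψ (Ideal.Quotient.mk _ _)
      rw [hx, hη]
      simp only [θ, map_add, map_sub, MvPolynomial.eval₂Hom_X']
      rw [hyg, hdiag, hdiag, ← map_add, ← map_sub]
      congr 1
      simp only [g, hd o j]
      ring
  have h3 : θ (η f) = 0 := eval₂_eq_zero_of_swap _ y hy (η f) (by
    rw [← AlgHom.comp_apply, ← h1]; exact hf)
  have h4 : ψ (Ideal.Quotient.mk _ f) = 0 := (congrArg (fun F => F f) h2).symm.trans h3
  exact Ideal.Quotient.eq_zero_iff_mem.1 (hψ (h4.trans (map_zero ψ).symm))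

lemma cmIdeal_isPrime {n : ℕ} (o : Fin n) : (cmIdeal n).IsPrime := by
  rw [le_antisymm (cmIdeal_le_ker n) (ker_le_cmIdeal o)]
  exact RingHom.ker_isPrime _

/-- Over a circuit variable `c`, the ring `ℚ[C]` is a polynomial ring in one variable whose
coefficients do not involve `c`. -/
lemma exists_supported_ringEquiv_polynomial {σ : Type*} {C : Set σ} (c : C) :
    ∃ E : MvPolynomial.supported ℚ C ≃+* Polynomial (MvPolynomial {x : C // x ≠ c} ℚ),
      ∀ a, (E.symm (Polynomial.C a) : MvPolynomial σ ℚ) ∈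
        MvPolynomial.supported ℚ (C \ {(c : σ)}) := by
  classical
  let E : MvPolynomial.supported ℚ C ≃ₐ[ℚ] Polynomial (MvPolynomial {x : C // x ≠ c} ℚ) :=
    (MvPolynomial.supportedEquivMvPolynomial C).trans
      ((MvPolynomial.renameEquiv ℚ (Equiv.optionSubtypeNe c).symm).trans
        (MvPolynomial.optionEquivLeft ℚ _))
  refine ⟨E.toRingEquiv, fun a => ?_⟩
  have h : (MvPolynomial.supported ℚ C).val.comp (E.symm.toAlgHom.comp Polynomial.CAlgHom) =
      MvPolynomial.rename (fun x : {x : C // x ≠ c} => (x : σ)) := by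
    refine MvPolynomial.algHom_ext fun x => ?_
    simp [E]
  have ha : (E.symm (Polynomial.C a) : MvPolynomial σ ℚ) =
      MvPolynomial.rename (fun x : {x : C // x ≠ c} => (x : σ)) a := congrArg (fun F => F a) h
  change (E.symm (Polynomial.C a) : MvPolynomial σ ℚ) ∈ _
  rw [ha, MvPolynomial.mem_supported]
  intro x hx
  obtain ⟨y, -, rfl⟩ := Finset.mem_image.1 (MvPolynomial.vars_rename _ _ hx)
  exact ⟨y.1.2, fun hy => y.2 (Subtype.ext hy)⟩

/-- For a circuit `C` of the algebraic rigidity matroid, the ideal `CM_n ∩ ℚ[C]` of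
`ℚ[C]` is principal, generated by an irreducible polynomial `p_C`, which is unique up
to multiplication by a nonzero rational number. -/
theorem circuit_polynomial_exists_unique (n : ℕ) (hn : 4 ≤ n)
    (C : Set (XVar n)) (hC : IsAlgCircuit n C) :
    ∃ p : MvPolynomial.supported ℚ C, Irreducible p ∧
      cmRestrict n C = Ideal.span {p} ∧
      ∀ q : MvPolynomial.supported ℚ C, cmRestrict n C = Ideal.span {q} →
        ∃ c : ℚ, c ≠ 0 ∧ q = c • p := by
  have hprime := cmIdeal_isPrime (⟨0, by omega⟩ : Fin n)
  obtain ⟨⟨f, hf, hfC, hf0⟩, hmin⟩ := hC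
  have hne : C.Nonempty := by
    rw [Set.nonempty_iff_ne_empty]
    rintro rfl
    rw [MvPolynomial.supported_empty, Algebra.mem_bot] at hfC
    obtain ⟨r, rfl⟩ := hfC
    have hr : r ≠ 0 := fun h => hf0 (by rw [h, map_zero])
    exact hprime.ne_top (Ideal.eq_top_of_isUnit_mem _ hf ((IsUnit.mk0 r hr).map _))
  obtain ⟨c, hc⟩ := hne
  obtain ⟨E, hE⟩ := exists_supported_ringEquiv_polynomial (⟨c, hc⟩ : C)
  have hrp : (cmRestrict n C).IsPrime := Ideal.IsPrime.comap _
  obtain ⟨p, hp, hspan⟩ := exists_prime_span_of_comap_C_eq_bot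
    ((cmRestrict n C).comap E.symm) (Ideal.IsPrime.comap _)
    (fun h => hf0 (by
      have hmem : E ⟨f, hfC⟩ ∈ (cmRestrict n C).comap E.symm := by
        rw [Ideal.mem_comap, E.symm_apply_apply]
        exact hf
      rw [h, Ideal.mem_bot, map_eq_zero_iff E E.injective] at hmem
      exact congrArg Subtype.val hmem))
    (fun a ha => by
      have h0 := hmin (C \ {c}) ⟨Set.sdiff_subset, fun h => (h hc).2 rfl⟩ _ ha (hE a)
      have h1 : E.symm (Polynomial.C a) = 0 := Subtype.ext h0
      rwa [map_eq_zero_iff E.symm E.symm.injective, Polynomial.C_eq_zero] at h1)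
  have hgen : cmRestrict n C = Ideal.span {E.symm p} := by
    ext x
    have hx : x ∈ cmRestrict n C ↔ E x ∈ (cmRestrict n C).comap E.symm := by
      rw [Ideal.mem_comap, E.symm_apply_apply]
    rw [hx, hspan, Ideal.mem_span_singleton, Ideal.mem_span_singleton, ← map_dvd_iff E.symm,
      E.symm_apply_apply]
  refine ⟨E.symm p, ((MulEquiv.prime_iff E.symm).2 hp).irreducible, hgen, fun q hq => ?_⟩
  obtain ⟨u, hu⟩ := Ideal.span_singleton_eq_span_singleton.1 (hgen.symm.trans hq)
  obtain ⟨r, hr, hur⟩ := MvPolynomial.isUnit_iff_eq_C_of_isReduced.1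
    (u.isUnit.map (MvPolynomial.supported ℚ C).val)
  refine ⟨r, hr.ne_zero, Subtype.ext ?_⟩
  have hur : ((u : MvPolynomial.supported ℚ C) : MvPolynomial (XVar n) ℚ) = MvPolynomial.C r := hur
  rw [← hu, MulMemClass.coe_mul, hur, mul_comm, ← MvPolynomial.smul_eq_C_mul]
  rfl

end
end
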